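/- arXiv:1103.2114 — 2 statements merged into one kernel-verified Lean document; each statement's English description precedes it below -/
import Mathlib

section
/- Let (K, v) be a field with a p-Henselian valuation (p a prime) and let F̃ be a degree-p extension of the residue field K̂ inside its maximal p-extension K̂(p). Then F̃ has an inertial lift in K(p) over K: there exists an extension F of K inside K(p) such that v extends uniquely (up to equivalence) to F, the residue field F̂ of this extension is K̂-isomorphic to F̃, and [F : K] = [F̂ : K̂] = p. -/
/-- The maximal p-extension K(p) of a field K: the compositum, inside a fixed
algebraic closure, of all finite Galois extensions of K of p-power degree. -/
noncomputable def pClosure (p : ℕ) (K : Type*) [Field K] :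
    IntermediateField K (AlgebraicClosure K) :=
  ⨆ L ∈ {L : IntermediateField K (AlgebraicClosure K) |
      FiniteDimensional K L ∧ IsGalois K L ∧ ∃ n : ℕ, Module.finrank K L = p ^ n}, L

/-- A valuation (given by its valuation subring `O`) is p-Henselian if it extends
uniquely, up to equivalence, to every intermediate field of K(p)/K. -/
def PHenselian (p : ℕ) {K : Type*} [Field K] (O : ValuationSubring K) : Prop :=
  ∀ L : IntermediateField K (pClosure p K),
    ∃! O' : ValuationSubring L, O'.comap (algebraMap K L) = O

section

open IsLocalRing Polynomial

theorem aux_exists_ext {K Ω : Type*} [Field K] [Field Ω] [Algebra K Ω] (O : ValuationSubring K) :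
    ∃ A : ValuationSubring Ω, A.comap (algebraMap K Ω) = O := by
  let R : LocalSubring Ω := LocalSubring.map (algebraMap K Ω) O.toLocalSubring
  obtain ⟨A, hA⟩ := R.exists_le_valuationSubring
  refine ⟨A, ?_⟩
  have key : ∀ x ∈ O, algebraMap K Ω x ∈ A := fun x hx => hA.1 ⟨x, hx, rfl⟩
  ext x
  rw [ValuationSubring.mem_comap]
  refine ⟨fun hx => ?_, key x⟩
  by_contra hxO
  have hx0 : x ≠ 0 := by rintro rfl; exact hxO O.zero_mem
  have hi : x⁻¹ ∈ O := (O.mem_or_inv_mem x).resolve_left hxO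
  have hmem : algebraMap K Ω x⁻¹ ∈ R.toSubring := ⟨_, hi, rfl⟩
  have : IsUnit (Subring.inclusion hA.1 ⟨algebraMap K Ω x⁻¹, hmem⟩) := by
    refine isUnit_iff_exists_inv.mpr ⟨⟨algebraMap K Ω x, hx⟩, Subtype.ext ?_⟩
    show algebraMap K Ω x⁻¹ * algebraMap K Ω x = 1
    rw [← map_mul, inv_mul_cancel₀ hx0, map_one]
  obtain ⟨⟨y, z, hz, hzy⟩, hy⟩ := isUnit_iff_exists_inv.mp (hA.2.1 _ this)
  have h1 : algebraMap K Ω x⁻¹ * y = 1 := congrArg Subtype.val hy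
  rw [← hzy] at h1
  have h2 : algebraMap K Ω (x⁻¹ * z) = algebraMap K Ω 1 := by
    rw [map_mul, map_one]; exact h1
  have h3 := (algebraMap K Ω).injective h2
  have : z = x := by field_simp at h3; exact h3
  exact hxO (this ▸ hz)

theorem aux_mem_of_monic {Ω : Type*} [Field Ω] (A : ValuationSubring Ω) (f : A[X]) (hf : f.Monic)
    (x : Ω) (hx : (f.map A.subtype).eval x = 0) : x ∈ A := by
  have : IsIntegral A x := ⟨f, hf, by rw [← hx, eval_map]; rfl⟩
  obtain ⟨y, hy⟩ := IsIntegrallyClosed.isIntegral_iff.mp this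
  rw [← hy]; exact y.2

theorem aux_algClosed {Ω : Type*} [Field Ω] [IsAlgClosed Ω] (A : ValuationSubring Ω) :
    IsAlgClosed (ResidueField A) := by
  refine IsAlgClosed.of_exists_root _ fun f hf hirr => ?_
  have hl : f ∈ lifts (residue A) := by
    rw [lifts_iff_coeff_lifts]; intro n; exact residue_surjective _
  obtain ⟨g, hg, hgd, hgm⟩ := lifts_and_natDegree_eq_and_monic hl hf
  have hd : (g.map A.subtype).degree ≠ 0 := by
    rw [hgm.degree_map, ← hgm.degree_map (residue A), hg]
    exact (degree_pos_of_irreducible hirr).ne'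
  obtain ⟨x, hx⟩ := IsAlgClosed.exists_root _ hd
  have hxA := aux_mem_of_monic A g hgm x hx
  refine ⟨residue A ⟨x, hxA⟩, ?_⟩
  rw [← hg, eval_map]
  refine (hom_eval₂ g (RingHom.id A) (residue A) ⟨x, hxA⟩).symm.trans ?_
  have : eval₂ (RingHom.id A) ⟨x, hxA⟩ g = 0 := by
    apply Subtype.ext
    have := hom_eval₂ g (RingHom.id A) A.subtype ⟨x, hxA⟩
    refine this.trans ?_
    rw [IsRoot, eval_map] at hx
    exact hx
  rw [this, map_zero]

theorem aux_lift_li {Ω E k' : Type*} [Field Ω] (A : ValuationSubring Ω) [Field E] [Algebra E Ω]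
    [Field k'] [Algebra k' (ResidueField A)]
    (hres : ∀ (a : E) (y : A), y.1 = algebraMap E Ω a →
      ∃ c : k', residue A y = algebraMap k' _ c)
    {ι : Type*} [Finite ι] (z : ι → A) (hz : LinearIndependent k' (fun i => residue A (z i))) :
    LinearIndependent E (fun i => (z i : Ω)) := by
  classical
  cases nonempty_fintype ι
  rw [Fintype.linearIndependent_iff] at hz ⊢
  intro g hg
  by_contra! hne
  obtain ⟨i0, hi0⟩ := hne
  obtain ⟨m, -, hm⟩ := Finset.exists_max_image Finset.univ
    (fun i => A.valuation (algebraMap E Ω (g i))) ⟨i0, Finset.mem_univ _⟩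
  have hgm : g m ≠ 0 := by
    intro h0
    have := hm i0 (Finset.mem_univ _)
    rw [h0, map_zero, map_zero, le_zero_iff, map_eq_zero, map_eq_zero] at this
    exact hi0 this
  have hgm' : algebraMap E Ω (g m) ≠ 0 := by simpa using hgm
  have hA : ∀ i, algebraMap E Ω (g i / g m) ∈ A := by
    intro i
    rw [← A.valuation_le_one_iff, map_div₀, map_div₀]
    exact div_le_one_of_le₀ (hm i (Finset.mem_univ _)) zero_le
  choose c hc using fun i => hres (g i / g m) ⟨_, hA i⟩ rfl
  have hsum : ∑ i, c i • residue A (z i) = 0 := by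
    have : ∑ i, (⟨_, hA i⟩ : A) * z i = 0 := by
      apply Subtype.ext
      have : ∀ i, algebraMap E Ω (g i / g m) * (z i : Ω)
        = (algebraMap E Ω (g m))⁻¹ * (g i • (z i : Ω)) := by
        intro i
        rw [Algebra.smul_def, map_div₀]; field_simp
      refine (map_sum A.subtype _ _).trans ?_
      refine (Finset.sum_congr rfl fun i _ => this i).trans ?_
      rw [← Finset.mul_sum, hg, mul_zero]; rfl
    have h2 := congrArg (residue A) this
    rw [map_sum, map_zero] at h2
    rw [← h2]
    refine Finset.sum_congr rfl fun i _ => ?_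
    rw [map_mul, hc, Algebra.smul_def]
  have hcm := hz c hsum m
  have := hc m
  rw [hcm, map_zero] at this
  have h1 : (⟨_, hA m⟩ : A) = 1 := Subtype.ext (by
    show algebraMap E Ω (g m / g m) = 1
    rw [div_self hgm, map_one])
  rw [h1, map_one] at this
  exact one_ne_zero this

/-- The residue field of an intermediate field, inside the residue field of the top field. -/
def auxRes {K Ω k : Type*} [Field K] [Field Ω] [Algebra K Ω] (A : ValuationSubring Ω) [Field k]
    [Algebra k (ResidueField A)]
    (hk' : ∀ c : k, ∃ (a : K) (y : A), y.1 = algebraMap K Ω a ∧ residue A y = algebraMap k _ c)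
    (F : IntermediateField K Ω) : IntermediateField k (ResidueField A) where
  carrier := {x | ∃ y : A, y.1 ∈ F ∧ residue A y = x}
  mul_mem' := by
    rintro _ _ ⟨y, hy, rfl⟩ ⟨z, hz, rfl⟩
    exact ⟨y * z, F.mul_mem hy hz, map_mul _ _ _⟩
  add_mem' := by
    rintro _ _ ⟨y, hy, rfl⟩ ⟨z, hz, rfl⟩
    exact ⟨y + z, F.add_mem hy hz, map_add _ _ _⟩
  algebraMap_mem' := by
    intro c
    obtain ⟨a, y, h1, h2⟩ := hk' c
    exact ⟨y, h1 ▸ F.algebraMap_mem a, h2⟩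
  inv_mem' := by
    rintro _ ⟨y, hy, rfl⟩
    by_cases h : residue A y = 0
    · exact ⟨0, F.zero_mem, by simp [h]⟩
    · have hu : IsUnit y := (residue_ne_zero_iff_isUnit y).mp h
      obtain ⟨z, hz⟩ := isUnit_iff_exists_inv.mp hu
      have hz1 : y.1 * z.1 = 1 := congrArg Subtype.val hz
      refine ⟨z, ?_, ?_⟩
      · rw [eq_inv_of_mul_eq_one_right hz1]
        exact F.inv_mem hy
      · have := congrArg (residue A) hz
        rw [map_mul, map_one] at this
        exact eq_inv_of_mul_eq_one_right this

theorem aux_mem_res {K Ω k : Type*} [Field K] [Field Ω] [Algebra K Ω] {A : ValuationSubring Ω}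
    [Field k] [Algebra k (ResidueField A)]
    (hk' : ∀ c : k, ∃ (a : K) (y : A), y.1 = algebraMap K Ω a ∧ residue A y = algebraMap k _ c)
    (F : IntermediateField K Ω) (x : ResidueField A) :
    x ∈ auxRes A hk' F ↔ ∃ y : A, y.1 ∈ F ∧ residue A y = x := Iff.rfl

theorem aux_res_finite {K Ω k : Type*} [Field K] [Field Ω] [Algebra K Ω] {A : ValuationSubring Ω}
    [Field k] [Algebra k (ResidueField A)]
    (hk : ∀ (a : K) (y : A), y.1 = algebraMap K Ω a → ∃ c : k, residue A y = algebraMap k _ c)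
    (hk' : ∀ c : k, ∃ (a : K) (y : A), y.1 = algebraMap K Ω a ∧ residue A y = algebraMap k _ c)
    (F : IntermediateField K Ω) [FiniteDimensional K F] :
    FiniteDimensional k (auxRes A hk' F) ∧
      Module.finrank k (auxRes A hk' F) ≤ Module.finrank K F := by
  have key : Module.rank k (auxRes A hk' F) ≤ (Module.finrank K F : ℕ) := by
    refine rank_le fun s hs => ?_
    choose y hy1 hy2 using fun i : s => (aux_mem_res hk' F i.1.1).mp i.1.2
    have h1 : LinearIndependent k (fun i : s => residue A (y i)) := by
      have := hs.map' (auxRes A hk' F).val.toLinearMap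
        (LinearMap.ker_eq_bot.mpr (auxRes A hk' F).val.injective)
      have e : (fun i : s => residue A (y i)) =
          (auxRes A hk' F).val.toLinearMap ∘ (fun i : s => i.1) := funext fun i => hy2 i
      rw [e]
      exact this
    have h2 := aux_lift_li A hk y h1
    have h3 : LinearIndependent K (fun i : s => (⟨(y i).1, hy1 i⟩ : F)) :=
      LinearIndependent.of_comp F.val.toLinearMap h2
    simpa using h3.fintype_card_le_finrank
  have hfd : FiniteDimensional k (auxRes A hk' F) :=
    Module.rank_lt_aleph0_iff.mp (key.trans_lt (Cardinal.natCast_lt_aleph0))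
  refine ⟨hfd, ?_⟩
  rw [← Module.finrank_eq_rank] at key
  exact_mod_cast key

theorem aux_descend {K Ω k : Type*} [Field K] [Field Ω] [Algebra K Ω] {A : ValuationSubring Ω}
    [Field k] [Algebra k (ResidueField A)]
    (hk : ∀ (a : K) (y : A), y.1 = algebraMap K Ω a → ∃ c : k, residue A y = algebraMap k _ c)
    (hk' : ∀ c : k, ∃ (a : K) (y : A), y.1 = algebraMap K Ω a ∧ residue A y = algebraMap k _ c)
    (p : ℕ) (hp : p.Prime) (D : IntermediateField k (ResidueField A)) [IsGalois k D]
    (hD : Module.finrank k D = p)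
    (F N : IntermediateField K Ω) (hFN : F ≤ N) [FiniteDimensional K N]
    (hF : Module.finrank K F = p) (hN : Module.finrank K N < p * p)
    (hDN : D ≤ auxRes A hk' N) : D = auxRes A hk' F := by
  have hFfd : FiniteDimensional K F := FiniteDimensional.of_finrank_pos (by rw [hF]; exact hp.pos)
  have hDfd : FiniteDimensional k D := FiniteDimensional.of_finrank_pos (by rw [hD]; exact hp.pos)
  obtain ⟨hJfd, hJ⟩ := aux_res_finite hk hk' F
  set J := auxRes A hk' F with hJdef
  suffices h : D ≤ J from IntermediateField.eq_of_le_of_finrank_le h (by omega)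
  by_contra hnot
  have hbot : D ⊓ J = ⊥ := by
    have hdvd : Module.finrank k (D ⊓ J : IntermediateField k (ResidueField A)) ∣ p := by
      rw [← hD]
      exact IntermediateField.finrank_dvd_of_le_right inf_le_left
    rcases (Nat.dvd_prime hp).mp hdvd with h | h
    · exact IntermediateField.finrank_eq_one_iff.mp h
    · exfalso
      apply hnot
      have := IntermediateField.eq_of_le_of_finrank_eq (inf_le_left : D ⊓ J ≤ D) (by rw [h, hD])
      exact inf_eq_left.mp this
  have hdisj : D.LinearDisjoint J := IntermediateField.LinearDisjoint.of_inf_eq_bot hbot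
  let b := Module.finBasis k D
  have hb := hdisj.linearIndependent_left b.linearIndependent
  choose y hy1 hy2 using fun i => (aux_mem_res hk' N (b i : ResidueField A)).mp (hDN (b i).2)
  have h2 : LinearIndependent F (fun i => (y i : Ω)) := by
    refine aux_lift_li (k' := J) A ?_ y ?_
    · intro a z hz
      exact ⟨⟨residue A z, z, by rw [hz]; exact a.2, rfl⟩, rfl⟩
    · convert hb using 1
      funext i
      exact hy2 i
  have h3 : LinearIndependent F
      (fun i => (⟨(y i).1, hy1 i⟩ : IntermediateField.extendScalars hFN)) :=
    LinearIndependent.of_comp (IntermediateField.extendScalars hFN).val.toLinearMap h2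
  have hmul : Module.finrank K F * Module.finrank F (IntermediateField.extendScalars hFN)
      = Module.finrank K N :=
    Module.finrank_mul_finrank K F (IntermediateField.extendScalars hFN)
  have hfd : FiniteDimensional F (IntermediateField.extendScalars hFN) := by
    have : FiniteDimensional K (IntermediateField.extendScalars hFN) :=
      inferInstanceAs (FiniteDimensional K N)
    exact FiniteDimensional.right K F _
  have h4 := h3.fintype_card_le_finrank
  rw [Fintype.card_fin, hD] at h4
  rw [hF] at hmul
  have := Nat.mul_le_mul_left p h4
  omega

theorem aux_assembly (p : ℕ) [Fact p.Prime] (K : Type*) [Field K]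
    (O : ValuationSubring K) (hO : PHenselian p O)
    (Ft : Type*) [Field Ft] [Algebra (ResidueField O) Ft]
    (hFt : Module.finrank (ResidueField O) Ft = p) [IsGalois (ResidueField O) Ft]
    (A : ValuationSubring (AlgebraicClosure K)) (hA : A.comap (algebraMap K _) = O)
    [Algebra (ResidueField O) (ResidueField A)]
    (hk : ∀ (x : O) (y : A), y.1 = algebraMap K _ x.1 →
      residue A y = algebraMap (ResidueField O) (ResidueField A) (residue O x))
    (hk' : ∀ c : ResidueField O, ∃ (a : K) (y : A),
      y.1 = algebraMap K _ a ∧ residue A y = algebraMap (ResidueField O) _ c)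
    (φ : Ft →ₐ[ResidueField O] ResidueField A)
    (F N : IntermediateField K (AlgebraicClosure K)) (hFN : F ≤ N) [FiniteDimensional K N]
    [IsGalois K F]
    (hF : Module.finrank K F = p) (hN : Module.finrank K N < p * p)
    (hDN : φ.fieldRange ≤ auxRes A hk' N) :
    ∃ F : IntermediateField K (pClosure p K), Module.finrank K F = p ∧
      ∃ OF : ValuationSubring F, OF.comap (algebraMap K F) = O ∧
        (∀ OF' : ValuationSubring F, OF'.comap (algebraMap K F) = O → OF' = OF) ∧
        ∃ e : IsLocalRing.ResidueField OF ≃+* Ft,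
          ∀ (x : O) (y : OF), y.1 = algebraMap K F (x : K) →
            e (IsLocalRing.residue OF y) =
              algebraMap (IsLocalRing.ResidueField O) Ft (IsLocalRing.residue O x) := by
  have hp : p.Prime := Fact.out
  have hFfd : FiniteDimensional K F := FiniteDimensional.of_finrank_pos (by rw [hF]; exact hp.pos)
  have hkk : ∀ (a : K) (y : A), y.1 = algebraMap K _ a →
      ∃ c : ResidueField O, residue A y = algebraMap (ResidueField O) _ c := by
    intro a y hy
    have ha : a ∈ O := by
      rw [← hA, ValuationSubring.mem_comap, ← hy]; exact y.2
    exact ⟨_, hk ⟨a, ha⟩ y hy⟩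
  have hgal : IsGalois (ResidueField O) φ.fieldRange :=
    IsGalois.of_algEquiv (AlgEquiv.ofInjectiveField φ)
  have hDp : Module.finrank (ResidueField O) φ.fieldRange = p := by
    rw [← hFt]
    exact (AlgEquiv.ofInjectiveField φ).toLinearEquiv.finrank_eq.symm
  have hD := aux_descend hkk hk' p hp φ.fieldRange hDp F N hFN hF hN hDN
  have hle : F ≤ pClosure p K := by
    unfold pClosure
    exact le_iSup₂_of_le F ⟨hFfd, inferInstance, 1, by rw [hF, pow_one]⟩ le_rfl
  let F' : IntermediateField K (pClosure p K) := IntermediateField.restrict hle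
  have eF : F ≃ₐ[K] F' := IntermediateField.restrictAlgEquiv hle
  let i : F' →+* AlgebraicClosure K := (algebraMap (pClosure p K) _).comp (algebraMap F' _)
  have hi : ∀ x : F', i x ∈ F := fun x => (IntermediateField.mem_restrict hle x.1).mp x.2
  have hi' : ∀ x ∈ F, ∃ y : F', i y = x := fun x hx =>
    ⟨⟨⟨x, hle hx⟩, (IntermediateField.mem_restrict hle _).mpr hx⟩, rfl⟩
  let OF : ValuationSubring F' := A.comap i
  have hOF : OF.comap (algebraMap K F') = O := by
    rw [← hA]; rfl
  have hOFmem : ∀ x : F', x ∈ OF ↔ i x ∈ A := fun x => Iff.rfl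
  refine ⟨F', eF.toLinearEquiv.finrank_eq.symm.trans hF, OF, hOF, fun OF' h' =>
    (hO F').unique h' hOF, ?_⟩
  let j : OF →+* A := i.restrict OF.toSubring A.toSubring (fun x hx => hx)
  have hj : ∀ x : OF, (j x).1 = i x.1 := fun x => rfl
  have hjl : IsLocalHom j := by
    constructor
    intro x hx
    obtain ⟨z, hz⟩ := isUnit_iff_exists_inv.mp hx
    have hz1 : i x.1 * z.1 = 1 := congrArg Subtype.val hz
    have hzi : z.1 = i (x.1)⁻¹ := by rw [map_inv₀]; exact eq_inv_of_mul_eq_one_right hz1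
    have hx0 : x.1 ≠ 0 := by
      intro h0; rw [h0, map_zero, zero_mul] at hz1; exact zero_ne_one hz1
    refine isUnit_iff_exists_inv.mpr ⟨⟨(x.1)⁻¹, ?_⟩, Subtype.ext (mul_inv_cancel₀ hx0)⟩
    rw [hOFmem, ← hzi]; exact z.2
  let ψ : ResidueField OF →+* ResidueField A := ResidueField.map j
  have hψ : ∀ y : OF, ψ (residue OF y) = residue A (j y) := fun y => ResidueField.map_residue j y
  have hran : ∀ x, x ∈ ψ.range ↔ x ∈ (φ : Ft →+* ResidueField A).range := by
    intro x
    have h1 : x ∈ (φ : Ft →+* ResidueField A).range ↔ x ∈ φ.fieldRange := Iff.rfl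
    rw [h1, hD, aux_mem_res]
    constructor
    · rintro ⟨y, rfl⟩
      obtain ⟨y, rfl⟩ := residue_surjective y
      exact ⟨j y, hi _, (hψ y).symm⟩
    · rintro ⟨y, hy, rfl⟩
      obtain ⟨z, hz⟩ := hi' _ hy
      have hzA : z ∈ OF := by rw [hOFmem, hz]; exact y.2
      refine ⟨residue OF ⟨z, hzA⟩, ?_⟩
      rw [hψ]
      congr 1
      exact Subtype.ext hz
  have hran' : ψ.range = (φ : Ft →+* ResidueField A).range := by
    ext x; exact hran x
  let e1 : ResidueField OF ≃+* ψ.range := RingEquiv.ofBijective ψ.rangeRestrict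
    ⟨fun a b h => ψ.injective (congrArg Subtype.val h), ψ.rangeRestrict_surjective⟩
  let e2 : Ft ≃+* (φ : Ft →+* ResidueField A).range :=
    RingEquiv.ofBijective (φ : Ft →+* ResidueField A).rangeRestrict
      ⟨fun a b h => φ.injective (congrArg Subtype.val h), RingHom.rangeRestrict_surjective _⟩
  let e : ResidueField OF ≃+* Ft := (e1.trans (RingEquiv.subringCongr hran')).trans e2.symm
  refine ⟨e, fun x y hxy => ?_⟩
  have he : e2 (e (residue OF y)) = RingEquiv.subringCongr hran' (e1 (residue OF y)) :=
    e2.apply_symm_apply _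
  apply e2.injective
  rw [he]
  apply Subtype.ext
  have l1 : ((RingEquiv.subringCongr hran' (e1 (residue OF y))) : ResidueField A)
      = ψ (residue OF y) := rfl
  have l2 : ((e2 (algebraMap (ResidueField O) Ft (residue O x))) : ResidueField A)
      = φ (algebraMap (ResidueField O) Ft (residue O x)) := rfl
  rw [l1, l2, hψ, AlgHom.commutes]
  apply hk
  rw [hj, hxy]
  rfl

theorem aux_sup_pow {k Ω : Type*} [Field k] [Field Ω] [Algebra k Ω] (p : ℕ) [Fact p.Prime]
    (L₁ L₂ : IntermediateField k Ω) [FiniteDimensional k L₁] [FiniteDimensional k L₂]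
    [IsGalois k L₁] [IsGalois k L₂] (h₁ : ∃ n, Module.finrank k L₁ = p ^ n)
    (h₂ : ∃ n, Module.finrank k L₂ = p ^ n) :
    ∃ n, Module.finrank k (L₁ ⊔ L₂ : IntermediateField k Ω) = p ^ n := by
  obtain ⟨a, ha⟩ := h₁
  obtain ⟨b, hb⟩ := h₂
  set E : IntermediateField k Ω := L₁ ⊔ L₂ with hE
  have hfd : FiniteDimensional k E := IntermediateField.finiteDimensional_sup L₁ L₂
  let M₁ : IntermediateField k E := IntermediateField.restrict (le_sup_left : L₁ ≤ E)
  let M₂ : IntermediateField k E := IntermediateField.restrict (le_sup_right : L₂ ≤ E)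
  let e₁ : L₁ ≃ₐ[k] M₁ := IntermediateField.restrictAlgEquiv _
  let e₂ : L₂ ≃ₐ[k] M₂ := IntermediateField.restrictAlgEquiv _
  have g₁ : IsGalois k M₁ := IsGalois.of_algEquiv e₁
  have g₂ : IsGalois k M₂ := IsGalois.of_algEquiv e₂
  have hg : IsGalois k E := inferInstance
  have i₁ : M₁.fixingSubgroup.index = p ^ a := by
    rw [← IntermediateField.finrank_eq_fixingSubgroup_index, ← ha]
    exact e₁.toLinearEquiv.finrank_eq.symm
  have i₂ : M₂.fixingSubgroup.index = p ^ b := by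
    rw [← IntermediateField.finrank_eq_fixingSubgroup_index, ← hb]
    exact e₂.toLinearEquiv.finrank_eq.symm
  have htop : M₁ ⊔ M₂ = ⊤ := by
    apply IntermediateField.lift_injective E
    rw [IntermediateField.lift_sup, IntermediateField.lift_restrict,
      IntermediateField.lift_restrict, IntermediateField.lift_top]
  have hpg : IsPGroup p Gal(E/k) := by
    intro g
    refine ⟨a + b, ?_⟩
    have m₁ : g ^ (p ^ (a + b)) ∈ M₁.fixingSubgroup := by
      rw [pow_add, pow_mul, ← i₁]
      exact Subgroup.pow_mem _ (Subgroup.pow_index_mem _ g) _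
    have m₂ : g ^ (p ^ (a + b)) ∈ M₂.fixingSubgroup := by
      rw [pow_add, mul_comm, pow_mul, ← i₂]
      exact Subgroup.pow_mem _ (Subgroup.pow_index_mem _ g) _
    have : g ^ (p ^ (a + b)) ∈ (M₁ ⊔ M₂).fixingSubgroup := by
      rw [IntermediateField.fixingSubgroup_sup]; exact ⟨m₁, m₂⟩
    rw [htop, IntermediateField.fixingSubgroup_top] at this
    exact this
  obtain ⟨n, hn⟩ := IsPGroup.iff_card.mp hpg
  exact ⟨n, by rw [← hn, IsGalois.card_aut_eq_finrank]⟩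

theorem aux_isGalois_of_finrank {k : Type*} [Field k] (p : ℕ) [Fact p.Prime]
    (Ft : IntermediateField k (pClosure p k)) (hFt : Module.finrank k Ft = p) :
    IsGalois k Ft := by
  have hp : p.Prime := Fact.out
  have hfd : FiniteDimensional k Ft :=
    FiniteDimensional.of_finrank_pos (by rw [hFt]; exact hp.pos)
  let E : IntermediateField k (AlgebraicClosure k) := IntermediateField.lift Ft
  let eE : Ft ≃ₐ[k] E := IntermediateField.liftAlgEquiv Ft
  have hEfd : FiniteDimensional k E := eE.toLinearEquiv.finiteDimensional
  let C : Set (IntermediateField k (AlgebraicClosure k)) :=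
    {L | FiniteDimensional k L ∧ IsGalois k L ∧ ∃ n : ℕ, Module.finrank k L = p ^ n}
  have hC : pClosure p k = sSup C := by rw [sSup_eq_iSup]; rfl
  have hle : E ≤ sSup C := hC ▸ IntermediateField.lift_le Ft
  have hne : C.Nonempty := ⟨⊥, inferInstance, inferInstance, 0, by simp⟩
  have hdir : DirectedOn (· ≤ ·) C := by
    rintro L₁ ⟨a1, a2, a3⟩ L₂ ⟨b1, b2, b3⟩
    exact ⟨L₁ ⊔ L₂, ⟨IntermediateField.finiteDimensional_sup L₁ L₂, inferInstance,
      aux_sup_pow p L₁ L₂ a3 b3⟩, le_sup_left, le_sup_right⟩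
  have hcpt : IsCompactElement E := by
    obtain ⟨s, hs⟩ := IntermediateField.fg_of_fg_toSubalgebra E
      (Subalgebra.fg_of_fg_toSubmodule (Module.Finite.iff_fg.mp hEfd))
    rw [← hs]
    exact IntermediateField.adjoin_finset_isCompactElement s
  obtain ⟨L, ⟨hL1, hL2, n, hn⟩, hEL⟩ :=
    (CompleteLattice.isCompactElement_iff_le_of_directed_sSup_le _ E).mp hcpt C hne hdir hle
  let M : IntermediateField k L := IntermediateField.restrict hEL
  let eM : E ≃ₐ[k] M := IntermediateField.restrictAlgEquiv hEL
  have hM : Module.finrank k M = p := by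
    rw [← eM.toLinearEquiv.finrank_eq, ← eE.toLinearEquiv.finrank_eq]; exact hFt
  have hi : M.fixingSubgroup.index = p := by
    rw [← IntermediateField.finrank_eq_fixingSubgroup_index, hM]
  have hcard : Nat.card Gal(L/k) = p ^ n := by rw [IsGalois.card_aut_eq_finrank, hn]
  have hn0 : n ≠ 0 := by
    rintro rfl
    have := M.fixingSubgroup.index_dvd_card
    rw [hcard, hi, pow_zero, Nat.dvd_one] at this
    exact hp.one_lt.ne' this
  have hnorm : M.fixingSubgroup.Normal := by
    apply Subgroup.normal_of_index_eq_minFac_card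
    rw [hi, hcard, hp.pow_minFac hn0]
  have hgM : IsGalois k M := by
    have := IsGalois.of_fixedField_normal_subgroup M.fixingSubgroup
    rwa [IsGalois.fixedField_fixingSubgroup] at this
  exact IsGalois.of_algEquiv (eE.trans eM).symm

/-- The twisted Kummer radicand. -/
noncomputable def auxB (p : ℕ) [Fact p.Prime] {K L : Type*} [Field K] [Field L] [Algebra K L]
    (C : K[X]) (ζ : L) : L :=
  ∏ j : (ZMod p)ˣ, (aeval (ζ ^ (j : ZMod p).val) C) ^ ((j⁻¹ : (ZMod p)ˣ) : ZMod p).val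

theorem aux_kummer_rel (p : ℕ) [Fact p.Prime] {K L : Type*} [Field K] [Field L] [Algebra K L]
    (C : K[X]) (ζ β : L) (hζ : IsPrimitiveRoot ζ p)
    (hC : ∀ j : (ZMod p)ˣ, aeval (ζ ^ (j : ZMod p).val) C ≠ 0)
    (hβ : β ^ p = auxB p C ζ) (σ : L →ₐ[K] L) :
    ∃ (s i : ℕ) (T : K[X]), σ ζ = ζ ^ s ∧ aeval ζ T ≠ 0 ∧ β ^ s = ζ ^ i * σ β * aeval ζ T := by
  have hp : p.Prime := Fact.out
  obtain ⟨s, hsp, hs⟩ := hζ.eq_pow_of_pow_eq_one (ξ := σ ζ)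
    (by rw [← map_pow, hζ.pow_eq_one, map_one])
  have hs0 : s ≠ 0 := by
    rintro rfl
    rw [pow_zero] at hs
    have : ζ = 1 := σ.injective (show σ ζ = σ 1 by rw [← hs, map_one])
    exact hζ.ne_one hp.one_lt this
  have hcop : s.Coprime p :=
    (Nat.Coprime.symm ((hp.coprime_iff_not_dvd).mpr (fun h => by
      have := Nat.le_of_dvd (Nat.pos_of_ne_zero hs0) h; omega)))
  let u : (ZMod p)ˣ := ZMod.unitOfCoprime s hcop
  have hu : (u : ZMod p).val = s := by
    rw [ZMod.coe_unitOfCoprime, ZMod.val_natCast, Nat.mod_eq_of_lt hsp]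
  set c : (ZMod p)ˣ → L := fun j => aeval (ζ ^ (j : ZMod p).val) C with hc
  set e : (ZMod p)ˣ → ℕ := fun j => ((j⁻¹ : (ZMod p)ˣ) : ZMod p).val with he
  have hb : auxB p C ζ = ∏ j, c j ^ e j := rfl
  have hb0 : auxB p C ζ ≠ 0 := by
    rw [hb]; exact Finset.prod_ne_zero_iff.mpr fun j _ => pow_ne_zero _ (hC j)
  have hβ0 : β ≠ 0 := by
    rintro rfl
    rw [zero_pow hp.ne_zero] at hβ
    exact hb0 hβ.symm
  have hσc : ∀ j, σ (c j) = c (u * j) := by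
    intro j
    simp only [hc]
    rw [← aeval_algHom_apply, map_pow, ← hs, ← pow_mul, Units.val_mul, ZMod.val_mul, hu,
      ← pow_eq_pow_mod _ hζ.pow_eq_one]
  have heu : ∀ j, e (u⁻¹ * j) = (s * e j) % p := by
    intro j
    simp only [he]
    rw [mul_inv_rev, inv_inv, Units.val_mul, ZMod.val_mul, hu, mul_comm]
  have hσb : σ (auxB p C ζ) = ∏ j, c j ^ ((s * e j) % p) := by
    rw [hb, map_prod, ← Equiv.prod_comp (Equiv.mulLeft u⁻¹)]
    refine Finset.prod_congr rfl fun j _ => ?_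
    rw [map_pow, Equiv.coe_mulLeft, hσc, mul_inv_cancel_left, heu]
  let T : K[X] := ∏ j : (ZMod p)ˣ, (C.comp (X ^ (j : ZMod p).val)) ^ ((s * e j) / p)
  have hT : aeval ζ T = ∏ j, c j ^ ((s * e j) / p) := by
    simp only [T, hc]
    rw [map_prod]
    refine Finset.prod_congr rfl fun j _ => ?_
    rw [map_pow, aeval_comp, map_pow, aeval_X]
  have hT0 : aeval ζ T ≠ 0 := by
    rw [hT]; exact Finset.prod_ne_zero_iff.mpr fun j _ => pow_ne_zero _ (hC j)
  have hbs : (auxB p C ζ) ^ s = σ (auxB p C ζ) * (aeval ζ T) ^ p := by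
    rw [hσb, hT, hb, ← Finset.prod_pow, ← Finset.prod_pow, ← Finset.prod_mul_distrib]
    refine Finset.prod_congr rfl fun j _ => ?_
    rw [← pow_mul, ← pow_mul, ← pow_add]
    congr 1
    rw [mul_comm (e j) s]
    exact (Nat.mod_add_div' _ _).symm
  have hσβ0 : σ β ≠ 0 := by rwa [Ne, map_eq_zero_iff σ σ.injective]
  obtain ⟨i, -, hi⟩ := hζ.eq_pow_of_pow_eq_one (ξ := β ^ s / (σ β * aeval ζ T)) (by
    rw [div_pow, mul_pow, ← map_pow, ← pow_mul, mul_comm s p, pow_mul, hβ, hbs, div_self]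
    refine mul_ne_zero ?_ (pow_ne_zero _ hT0)
    rwa [Ne, map_eq_zero_iff σ σ.injective])
  refine ⟨s, i, T, hs.symm, hT0, ?_⟩
  rw [hi]
  field_simp

theorem aux_kummer_descent (p : ℕ) [Fact p.Prime] {K Ω : Type*} [Field K] [Field Ω] [Algebra K Ω]
    [IsAlgClosure K Ω] (hpK : (p : K) ≠ 0)
    (C : K[X]) (ζ β : Ω) (hζ : IsPrimitiveRoot ζ p)
    (hC : ∀ j : (ZMod p)ˣ, aeval (ζ ^ (j : ZMod p).val) C ≠ 0)
    (hβ : β ^ p = auxB p C ζ) (N : IntermediateField K Ω)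
    (hN : N = IntermediateField.adjoin K {ζ, β}) :
    FiniteDimensional K N ∧ (p ≤ Module.finrank K N → Module.finrank K N < p * p ∧
      ∃ F : IntermediateField K Ω, F ≤ N ∧ IsGalois K F ∧ Module.finrank K F = p) := by
  have hp : p.Prime := Fact.out
  have hac : IsAlgClosed Ω := IsAlgClosure.isAlgClosed K
  have halg : Algebra.IsAlgebraic K Ω := IsAlgClosure.isAlgebraic
  have hnormΩ : Normal K Ω := IsAlgClosure.normal K Ω
  have hζN : ζ ∈ N := hN ▸ IntermediateField.subset_adjoin _ _ (by simp)
  have hβN : β ∈ N := hN ▸ IntermediateField.subset_adjoin _ _ (by simp)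
  have hfd : FiniteDimensional K N := by
    rw [hN]
    exact IntermediateField.finiteDimensional_adjoin
      (fun x _ => (halg.isAlgebraic x).isIntegral)
  refine ⟨hfd, fun hpN => ?_⟩
  have hnorm : Normal K N := by
    rw [IntermediateField.normal_iff_forall_map_le]
    intro σ
    rw [hN, IntermediateField.adjoin_map, IntermediateField.adjoin_le_iff, ← hN]
    obtain ⟨s, i, T, h1, h2, h3⟩ := aux_kummer_rel p C ζ β hζ hC hβ σ
    have hTN : aeval ζ T ∈ N := by
      have := (aeval (⟨ζ, hζN⟩ : N) T).2
      rwa [← IntermediateField.coe_val, ← aeval_algHom_apply] at this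
    rintro _ ⟨x, hx, rfl⟩
    rcases hx with rfl | rfl
    · show σ x ∈ N
      rw [h1]; exact pow_mem hζN _
    · show σ x ∈ N
      have hz : ζ ^ i ≠ 0 := pow_ne_zero _ (hζ.ne_zero hp.ne_zero)
      have : σ x = x ^ s / (ζ ^ i * aeval ζ T) := by
        rw [h3]; field_simp
      rw [this]
      exact div_mem (pow_mem hβN _) (mul_mem (pow_mem hζN _) hTN)
  have hpΩ : (p : Ω) ≠ 0 := by
    rw [← map_natCast (algebraMap K Ω), Ne, map_eq_zero]; exact hpK
  have hsepζ : IsSeparable K ζ := by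
    have : (X ^ p - 1 : K[X]).Separable := by
      have := separable_X_pow_sub_C (1 : K) (n := p) hpK one_ne_zero
      simpa using this
    exact this.of_dvd (minpoly.dvd K ζ (by simp [hζ.pow_eq_one]))
  have hb0 : auxB p C ζ ≠ 0 :=
    Finset.prod_ne_zero_iff.mpr fun j _ => pow_ne_zero _ (hC j)
  have hsepβ : IsSeparable K β := by
    let M := IntermediateField.adjoin K {ζ}
    have hM : Algebra.IsSeparable K M := by
      rw [IntermediateField.isSeparable_adjoin_iff_isSeparable]
      rintro x rfl; exact hsepζ
    have hζM : ζ ∈ M := IntermediateField.subset_adjoin _ _ (by simp)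
    have hbM : auxB p C ζ ∈ M := by
      refine prod_mem fun j _ => pow_mem ?_ _
      have := (aeval ((⟨ζ, hζM⟩ : M) ^ (j : ZMod p).val) C).2
      rwa [← IntermediateField.coe_val, ← aeval_algHom_apply] at this
    have hβM : IsSeparable M β := by
      have h1 : (X ^ p - Polynomial.C (⟨_, hbM⟩ : M) : M[X]).Separable :=
        separable_X_pow_sub_C _ (by
          intro h
          apply hpΩ
          have := congrArg (algebraMap M Ω) h
          simpa using this) (by
          intro h; exact hb0 (congrArg Subtype.val h))
      refine h1.of_dvd (minpoly.dvd M β ?_)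
      simp [hβ]
    exact IsSeparable.of_algebra_isSeparable_of_isSeparable K hβM
  have hsep : Algebra.IsSeparable K N := by
    rw [hN, IntermediateField.isSeparable_adjoin_iff_isSeparable]
    rintro x (rfl | rfl)
    · exact hsepζ
    · exact hsepβ
  have hgal : IsGalois K N := ⟨⟩
  -- work inside `N`
  let z : N := ⟨ζ, hζN⟩
  let b : N := ⟨β, hβN⟩
  have hz : IsPrimitiveRoot z p := IsPrimitiveRoot.of_map_of_injective (f := N.val)
    hζ N.val.injective
  have hval : ∀ x : N, ∀ f : K[X], ((aeval x f : N) : Ω) = aeval (x : Ω) f := by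
    intro x f
    rw [← IntermediateField.coe_val, ← aeval_algHom_apply]
  have hCz : ∀ j : (ZMod p)ˣ, aeval (z ^ (j : ZMod p).val) C ≠ 0 := by
    intro j h
    apply hC j
    have := congrArg Subtype.val h
    rw [hval] at this
    exact this
  have hbz : b ^ p = auxB p C z := by
    apply Subtype.ext
    show β ^ p = N.val (auxB p C z)
    rw [hβ]
    unfold auxB
    rw [map_prod]
    refine Finset.prod_congr rfl fun j _ => ?_
    rw [map_pow, ← aeval_algHom_apply]; rfl
  have hb0' : b ≠ 0 := by
    intro h
    have : β = 0 := congrArg Subtype.val h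
    rw [this, zero_pow hp.ne_zero] at hβ
    exact hb0 hβ.symm
  -- automorphisms are determined on z and b
  have hext : ∀ f g : Gal(N/K), f z = g z → f b = g b → f = g := by
    intro f g h1 h2
    have htop : IntermediateField.adjoin K {z, b} = ⊤ := by
      apply IntermediateField.lift_injective N
      rw [IntermediateField.lift_adjoin, IntermediateField.lift_top, Set.image_pair]
      exact hN.symm
    have hall : ∀ x ∈ IntermediateField.adjoin K {z, b}, f x = g x := by
      intro x hx
      induction hx using IntermediateField.adjoin_induction with
      | mem x hx =>
        rcases hx with rfl | rfl
        · exact h1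
        · exact h2
      | algebraMap x => rw [f.commutes, g.commutes]
      | add x y _ _ hx hy => rw [map_add, map_add, hx, hy]
      | inv x _ hx => rw [map_inv₀, map_inv₀, hx]
      | mul x y _ _ hx hy => rw [map_mul, map_mul, hx, hy]
    exact AlgEquiv.ext fun x => hall x (htop ▸ IntermediateField.mem_top)
  let χ : Gal(N/K) →* (ZMod p)ˣ := hz.autToPow K
  have hχ : ∀ f ∈ χ.ker, f z = z := by
    intro f hf
    have := hz.autToPow_spec K f
    rw [← this]
    have h1 : hz.autToPow K f = 1 := hf
    rw [h1, Units.val_one, ZMod.val_one, pow_one]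
  have hker : ∀ f ∈ χ.ker, ∃ i : Fin p, f b = z ^ (i : ℕ) * b := by
    intro f hf
    obtain ⟨i, hi, h⟩ := hz.eq_pow_of_pow_eq_one (ξ := f b / b) (by
      have h1 : f (auxB p C z) = auxB p C z := by
        unfold auxB
        rw [map_prod]
        refine Finset.prod_congr rfl fun j _ => ?_
        rw [map_pow, ← aeval_algHom_apply, map_pow, hχ f hf]
      rw [div_pow, ← map_pow, hbz, h1, ← hbz, div_self (pow_ne_zero _ hb0')])
    exact ⟨⟨i, hi⟩, by rw [h]; field_simp⟩
  have hcardle : Nat.card χ.ker ≤ p := by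
    choose i hi using fun f : χ.ker => hker f.1 f.2
    have : Function.Injective i := by
      intro f g hfg
      apply Subtype.ext
      apply hext
      · rw [hχ _ f.2, hχ _ g.2]
      · rw [hi f, hi g, hfg]
    simpa using Nat.card_le_card_of_injective i this
  have hpg : IsPGroup p χ.ker := by
    intro f
    refine ⟨1, Subtype.ext ?_⟩
    rw [pow_one]
    obtain ⟨i, hi⟩ := hker f.1 f.2
    have hfz := hχ f.1 f.2
    have key : ∀ n : ℕ, (f.1 ^ n) z = z ∧ (f.1 ^ n) b = z ^ ((i : ℕ) * n) * b := by
      intro n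
      induction n with
      | zero => simp
      | succ n ih =>
        rw [pow_succ', AlgEquiv.mul_apply, AlgEquiv.mul_apply, ih.1, ih.2, map_mul, map_pow, hfz,
          hi]
        refine ⟨rfl, ?_⟩
        ring
    apply hext
    · exact (key p).1
    · refine (key p).2.trans ?_
      rw [mul_comm (i : ℕ), pow_mul, hz.pow_eq_one]; simp
  have hidx : χ.ker.index ∣ p - 1 := by
    rw [Subgroup.index_ker]
    have := Subgroup.card_subgroup_dvd_card χ.range
    rwa [Nat.card_eq_fintype_card (α := (ZMod p)ˣ), ZMod.card_units] at this
  have hidxle : χ.ker.index ≤ p - 1 := Nat.le_of_dvd (by have := hp.two_le; omega) hidx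
  have hcard : Nat.card χ.ker * χ.ker.index = Module.finrank K N := by
    rw [Subgroup.card_mul_index, IsGalois.card_aut_eq_finrank]
  have hkp : Nat.card χ.ker = p := by
    obtain ⟨n, hn⟩ := IsPGroup.iff_card.mp hpg
    rcases n with _ | _ | n
    · rw [hn, pow_zero, one_mul] at hcard
      have := hp.two_le
      omega
    · simpa using hn
    · exfalso
      rw [hn] at hcardle
      have : p ^ 1 < p ^ (n + 2) := Nat.pow_lt_pow_right hp.one_lt (by omega)
      rw [pow_one] at this
      exact absurd hcardle (by simpa using this)
  refine ⟨?_, ?_⟩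
  · rw [← hcard, hkp]
    have := hp.two_le
    exact Nat.mul_lt_mul_of_pos_left (by omega) hp.pos
  have hcentral : ∀ f ∈ χ.ker, ∀ g : Gal(N/K), g * f = f * g := by
    intro f hf g
    obtain ⟨s, i, T, h1, h2, h3⟩ := aux_kummer_rel p C z b hz hCz hbz (g : N →ₐ[K] N)
    have h1' : g z = z ^ s := h1
    have h3' : b ^ s = z ^ i * g b * aeval z T := h3
    have hfz := hχ f hf
    obtain ⟨l, hl⟩ := hker f hf
    have hzi : z ^ i ≠ 0 := pow_ne_zero _ (hz.ne_zero hp.ne_zero)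
    have hgb : g b = b ^ s / (z ^ i * aeval z T) := by
      rw [h3']; field_simp
    have hfT : f (aeval z T) = aeval z T := by
      rw [← aeval_algHom_apply, hfz]
    apply hext
    · rw [AlgEquiv.mul_apply, AlgEquiv.mul_apply, hfz, h1', map_pow, hfz]
    · rw [AlgEquiv.mul_apply, AlgEquiv.mul_apply, hl, map_mul, map_pow, h1', hgb, map_div₀,
        map_mul, map_pow, map_pow, hfz, hfT, hl]
      ring
  obtain ⟨H, hH⟩ := Subgroup.exists_right_complement'_of_coprime (N := χ.ker) (by
    rw [hkp]
    refine Nat.Coprime.coprime_dvd_right hidx ?_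
    refine (hp.coprime_iff_not_dvd).mpr fun h => ?_
    have := Nat.le_of_dvd (by have := hp.two_le; omega) h
    have := hp.two_le
    omega)
  have hHn : H.Normal := by
    constructor
    intro h hh g
    have hg : g ∈ χ.ker ⊔ H := hH.sup_eq_top ▸ Subgroup.mem_top g
    rw [Subgroup.mem_sup_of_normal_left] at hg
    obtain ⟨f, hf, x, hx, rfl⟩ := hg
    have : f * x * h * (f * x)⁻¹ = x * h * x⁻¹ := by
      have h1 := hcentral f hf (x * h * x⁻¹)
      calc f * x * h * (f * x)⁻¹ = f * (x * h * x⁻¹) * f⁻¹ := by group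
        _ = x * h * x⁻¹ := by rw [← h1]; group
    rw [this]
    exact H.mul_mem (H.mul_mem hx hh) (H.inv_mem hx)
  let F0 : IntermediateField K N := IntermediateField.fixedField H
  have hF0 : IsGalois K F0 := IsGalois.of_fixedField_normal_subgroup H
  refine ⟨IntermediateField.lift F0, IntermediateField.lift_le F0,
    IsGalois.of_algEquiv (IntermediateField.liftAlgEquiv F0), ?_⟩
  rw [← (IntermediateField.liftAlgEquiv F0).toLinearEquiv.finrank_eq,
    IntermediateField.finrank_eq_fixingSubgroup_index,
    IntermediateField.fixingSubgroup_fixedField, hH.index_eq_card, hkp]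

theorem aux_range_le {k Ft κ : Type*} [Field k] [Field Ft] [Field κ] [Algebra k Ft] [Algebra k κ]
    (p : ℕ) [Fact p.Prime] (hFt : Module.finrank k Ft = p) (φ : Ft →ₐ[k] κ) (t : Ft)
    (ht : ∀ c : k, algebraMap k Ft c ≠ t) (D : IntermediateField k κ) (h : φ t ∈ D) :
    φ.fieldRange ≤ D := by
  have hp : p.Prime := Fact.out
  have hfd : FiniteDimensional k Ft :=
    FiniteDimensional.of_finrank_pos (by rw [hFt]; exact hp.pos)
  have htop : IntermediateField.adjoin k {t} = ⊤ := by
    have hdvd : Module.finrank k (IntermediateField.adjoin k {t}) ∣ p := by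
      rw [← hFt, ← Module.finrank_mul_finrank k (IntermediateField.adjoin k {t}) Ft]
      exact Dvd.intro _ rfl
    rcases (Nat.dvd_prime hp).mp hdvd with h1 | h1
    · exfalso
      rw [IntermediateField.finrank_eq_one_iff, IntermediateField.adjoin_simple_eq_bot_iff,
        IntermediateField.mem_bot] at h1
      obtain ⟨c, hc⟩ := h1
      exact ht c hc
    · exact IntermediateField.eq_of_le_of_finrank_eq le_top
        (by rw [h1, IntermediateField.finrank_top', hFt])
  rw [AlgHom.fieldRange_eq_map, ← htop, IntermediateField.adjoin_map,
    IntermediateField.adjoin_le_iff]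
  rintro _ ⟨x, hx, rfl⟩
  rw [Set.mem_singleton_iff] at hx
  subst hx
  exact h

theorem aux_le_finrank {K Ω k Ft : Type*} [Field K] [Field Ω] [Algebra K Ω]
    {A : ValuationSubring Ω} [Field k] [Field Ft] [Algebra k Ft]
    [Algebra k (ResidueField A)]
    (hk : ∀ (a : K) (y : A), y.1 = algebraMap K Ω a → ∃ c : k, residue A y = algebraMap k _ c)
    (hk' : ∀ c : k, ∃ (a : K) (y : A), y.1 = algebraMap K Ω a ∧ residue A y = algebraMap k _ c)
    (φ : Ft →ₐ[k] ResidueField A)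
    (N : IntermediateField K Ω) [FiniteDimensional K N] (h : φ.fieldRange ≤ auxRes A hk' N) :
    Module.finrank k Ft ≤ Module.finrank K N := by
  obtain ⟨h1, h2⟩ := aux_res_finite hk hk' N
  refine le_trans ?_ h2
  let f : Ft →ₐ[k] auxRes A hk' N := φ.codRestrict (auxRes A hk' N).toSubalgebra
    (fun x => h ⟨x, rfl⟩)
  exact LinearMap.finrank_le_finrank_of_injective (f := f.toLinearMap) f.injective

theorem aux_finish_kummer {K Ω k Ft : Type*} [Field K] [Field Ω] [Algebra K Ω]
    {A : ValuationSubring Ω} [Field k] [Field Ft] [Algebra k Ft]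
    [Algebra k (ResidueField A)]
    (hk : ∀ (a : K) (y : A), y.1 = algebraMap K Ω a → ∃ c : k, residue A y = algebraMap k _ c)
    (hk' : ∀ c : k, ∃ (a : K) (y : A), y.1 = algebraMap K Ω a ∧ residue A y = algebraMap k _ c)
    (φ : Ft →ₐ[k] ResidueField A)
    (p : ℕ) [Fact p.Prime] (hFt : Module.finrank k Ft = p)
    [IsAlgClosure K Ω] (hpK : (p : K) ≠ 0)
    (C : K[X]) (ζ β : Ω) (hζ : IsPrimitiveRoot ζ p)
    (hC : ∀ j : (ZMod p)ˣ, aeval (ζ ^ (j : ZMod p).val) C ≠ 0)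
    (hβ : β ^ p = auxB p C ζ)
    (hN : φ.fieldRange ≤ auxRes A hk' (IntermediateField.adjoin K {ζ, β})) :
    ∃ F N : IntermediateField K Ω, F ≤ N ∧ FiniteDimensional K N ∧ IsGalois K F ∧
      Module.finrank K F = p ∧ Module.finrank K N < p * p ∧ φ.fieldRange ≤ auxRes A hk' N := by
  obtain ⟨hfd, h⟩ := aux_kummer_descent p hpK C ζ β hζ hC hβ _ rfl
  obtain ⟨h1, F, h2, h3, h4⟩ := h (hFt ▸ aux_le_finrank hk hk' φ _ hN)
  exact ⟨F, _, h2, hfd, h3, h4, h1, hN⟩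

theorem aux_generator {k Ft : Type*} [Field k] [Field Ft] [Algebra k Ft] (p : ℕ) [Fact p.Prime]
    (hFt : Module.finrank k Ft = p) [IsGalois k Ft] :
    ∃ σ : Gal(Ft/k), orderOf σ = p ∧ (∀ τ : Gal(Ft/k), ∃ i < p, τ = σ ^ i) ∧
      ∀ x : Ft, σ x = x → ∃ c : k, algebraMap k Ft c = x := by
  have hp : p.Prime := Fact.out
  have hfd : FiniteDimensional k Ft :=
    FiniteDimensional.of_finrank_pos (by rw [hFt]; exact hp.pos)
  have hcard : Nat.card Gal(Ft/k) = p := by rw [IsGalois.card_aut_eq_finrank, hFt]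
  have hcyc : IsCyclic Gal(Ft/k) := isCyclic_of_prime_card hcard
  obtain ⟨σ, hσ⟩ := hcyc.exists_generator
  have hord : orderOf σ = p := by rw [orderOf_eq_card_of_forall_mem_zpowers hσ, hcard]
  have hpow : ∀ τ : Gal(Ft/k), ∃ i < p, τ = σ ^ i := by
    intro τ
    obtain ⟨i, hi⟩ := (mem_powers_iff_mem_zpowers.mpr (hσ τ) : τ ∈ Submonoid.powers σ)
    refine ⟨i % p, Nat.mod_lt _ hp.pos, ?_⟩
    rw [← hi, ← hord, pow_mod_orderOf]
  refine ⟨σ, hord, hpow, fun x hx => ?_⟩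
  refine (IsGalois.mem_range_algebraMap_iff_fixed x).mpr fun τ => ?_
  obtain ⟨i, -, rfl⟩ := hpow τ
  clear * - hx
  induction i with
  | zero => simp
  | succ n ih => rw [pow_succ, AlgEquiv.mul_apply, hx, ih]

theorem aux_artin_schreier {k Ft : Type*} [Field k] [Field Ft] [Algebra k Ft] (p : ℕ)
    [Fact p.Prime] [CharP k p] (hFt : Module.finrank k Ft = p) [IsGalois k Ft] :
    ∃ (t : Ft) (c : k), (∀ c : k, algebraMap k Ft c ≠ t) ∧ t ^ p - t = algebraMap k Ft c := by
  classical
  have hp : p.Prime := Fact.out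
  obtain ⟨σ, hord, hpow, hfix⟩ := aux_generator p hFt
  let S : Module.End k Ft := σ.toLinearMap
  have hSp : ∀ n, S ^ n = (σ ^ n).toLinearMap := by
    intro n
    induction n with
    | zero => rfl
    | succ n ih => rw [pow_succ, ih, pow_succ]; rfl
  have : CharP (Module.End k Ft) p :=
    charP_of_injective_algebraMap (algebraMap k (Module.End k Ft)).injective p
  have hnil : (S - 1) ^ p = 0 := by
    rw [sub_pow_char_of_commute p (Commute.one_right S), hSp, ← hord, pow_orderOf_eq_one, one_pow]
    exact sub_self _
  have hex : ∃ n, (S - 1) ^ n = 0 := ⟨p, hnil⟩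
  have h0 : Nat.find hex ≠ 0 := by
    intro h
    have := Nat.find_spec hex
    rw [h, pow_zero] at this
    exact one_ne_zero this
  have h1 : Nat.find hex ≠ 1 := by
    intro h
    have := Nat.find_spec hex
    rw [h, pow_one, sub_eq_zero] at this
    have h2 : σ = 1 := AlgEquiv.ext fun x => LinearMap.congr_fun this x
    rw [h2, orderOf_one] at hord
    exact hp.one_lt.ne hord
  obtain ⟨m, hm⟩ : ∃ m, Nat.find hex = m + 2 := ⟨Nat.find hex - 2, by omega⟩
  have hne : (S - 1) ^ (m + 1) ≠ 0 := Nat.find_min hex (by omega)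
  have hz : (S - 1) ^ (m + 2) = 0 := hm ▸ Nat.find_spec hex
  obtain ⟨x, hx⟩ : ∃ x, ((S - 1) ^ (m + 1)) x ≠ 0 := by
    by_contra! h
    exact hne (LinearMap.ext h)
  set y := ((S - 1) ^ m) x with hy
  set z := ((S - 1) ^ (m + 1)) x with hzd
  have e1 : σ y = y + z := by
    have : z = (S - 1) y := by rw [hzd, pow_succ']; rfl
    rw [this]
    show σ y = y + (σ y - y)
    ring
  have e2 : σ z = z := by
    have : (S - 1) z = 0 := by
      have := LinearMap.congr_fun hz x
      rw [pow_succ'] at this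
      exact this
    exact sub_eq_zero.mp this
  have e3 : σ (y / z) = y / z + 1 := by
    rw [map_div₀, e1, e2]; field_simp
  have : CharP Ft p := charP_of_injective_algebraMap (algebraMap k Ft).injective p
  obtain ⟨c, hc⟩ := hfix ((y / z) ^ p - y / z) (by
    rw [map_sub, map_pow, e3, add_pow_char, one_pow]; ring)
  refine ⟨y / z, c, fun d hd => ?_, hc.symm⟩
  rw [← hd, σ.commutes] at e3
  exact one_ne_zero (left_eq_add.mp e3)

theorem aux_as_mem {κ : Type*} [Field κ] (p : ℕ) [Fact p.Prime] [CharP κ p] (D : Subfield κ)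
    (x y : κ) (h : x ^ p - x = y ^ p - y) (hx : x ∈ D) : y ∈ D := by
  have h1 : (y - x) ∈ (⊥ : Subfield κ) := by
    rw [Subfield.mem_bot_iff_pow_eq_self κ p, sub_pow_char]
    linear_combination -h
  have h2 : (y - x) ∈ D := (bot_le : ⊥ ≤ D) h1
  have := D.add_mem h2 hx
  simpa using this

theorem aux_root_mem {Ω : Type*} [Field Ω] (A : ValuationSubring Ω) (n : ℕ) (hn : 2 ≤ n)
    (d a : A) (x : Ω) (hx : x ^ n = d * x + a) : x ∈ A := by
  refine aux_mem_of_monic A (X ^ n - (C d * X + C a)) ?_ x ?_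
  · apply monic_X_pow_sub
    refine lt_of_le_of_lt (degree_linear_le) ?_
    exact_mod_cast hn
  · simp only [Polynomial.map_sub, Polynomial.map_pow, map_X, Polynomial.map_add,
      Polynomial.map_mul, map_C, eval_sub, eval_pow, eval_X, eval_add, eval_mul, eval_C]
    rw [hx]
    exact sub_self _

theorem aux_case1a {K Ω k Ft : Type*} [Field K] [Field Ω] [Algebra K Ω]
    {A : ValuationSubring Ω} [Field k] [Field Ft] [Algebra k Ft]
    [Algebra k (ResidueField A)]
    (hk : ∀ (a : K) (y : A), y.1 = algebraMap K Ω a → ∃ c : k, residue A y = algebraMap k _ c)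
    (hk' : ∀ c : k, ∃ (a : K) (y : A), y.1 = algebraMap K Ω a ∧ residue A y = algebraMap k _ c)
    (φ : Ft →ₐ[k] ResidueField A)
    (p : ℕ) [Fact p.Prime] (hFt : Module.finrank k Ft = p) [IsGalois k Ft]
    [IsAlgClosure K Ω] [CharP K p] [CharP k p] :
    ∃ F N : IntermediateField K Ω, F ≤ N ∧ FiniteDimensional K N ∧ IsGalois K F ∧
      Module.finrank K F = p ∧ Module.finrank K N < p * p ∧ φ.fieldRange ≤ auxRes A hk' N := by
  have hp : p.Prime := Fact.out
  have hac : IsAlgClosed Ω := IsAlgClosure.isAlgClosed K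
  have halg : Algebra.IsAlgebraic K Ω := IsAlgClosure.isAlgebraic
  have hnormΩ : Normal K Ω := IsAlgClosure.normal K Ω
  have : CharP Ω p := charP_of_injective_algebraMap (algebraMap K Ω).injective p
  have : CharP (ResidueField A) p :=
    charP_of_injective_algebraMap (algebraMap k (ResidueField A)).injective p
  obtain ⟨t, a0, ht, hta⟩ := aux_artin_schreier p hFt
  obtain ⟨c, yc, hyc, hyc'⟩ := hk' a0
  let f : K[X] := X ^ p - (X + C c)
  have hfdeg : (X + C c : K[X]).degree < p := by
    rw [degree_X_add_C]; exact_mod_cast hp.one_lt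
  have hfm : f.Monic := monic_X_pow_sub hfdeg
  have hfd : f.natDegree = p := by
    apply natDegree_eq_of_degree_eq_some
    exact (degree_sub_eq_left_of_degree_lt (by rwa [degree_X_pow])).trans (degree_X_pow _)
  obtain ⟨x, hx⟩ := IsAlgClosed.exists_aeval_eq_zero Ω f (by
    rw [degree_eq_natDegree hfm.ne_zero, hfd]; exact_mod_cast hp.ne_zero)
  have hx1 : x ^ p = x + algebraMap K Ω c := by
    simpa [f, sub_eq_zero] using hx
  have hxA : x ∈ A := aux_root_mem A p hp.two_le 1 yc x (by rw [hx1, hyc]; simp)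
  let N : IntermediateField K Ω := IntermediateField.adjoin K {x}
  have hxN : x ∈ N := IntermediateField.subset_adjoin _ _ (by simp)
  have hint : IsIntegral K x := (halg.isAlgebraic x).isIntegral
  have hNfd : FiniteDimensional K N := IntermediateField.adjoin.finiteDimensional hint
  have hle : Module.finrank K N ≤ p := by
    rw [IntermediateField.adjoin.finrank hint, ← hfd]
    exact natDegree_le_of_dvd (minpoly.dvd K x hx) hfm.ne_zero
  have hnorm : Normal K N := by
    rw [IntermediateField.normal_iff_forall_map_le]
    intro σ
    rw [IntermediateField.adjoin_map, IntermediateField.adjoin_le_iff]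
    rintro _ ⟨x', hx', rfl⟩
    rw [Set.mem_singleton_iff] at hx'
    subst hx'
    refine aux_as_mem p N.toSubfield x' _ ?_ hxN
    show x' ^ p - x' = (σ x') ^ p - σ x'
    rw [← map_pow, hx1, map_add, σ.commutes]
    ring
  have hsep : Algebra.IsSeparable K N := by
    rw [IntermediateField.isSeparable_adjoin_iff_isSeparable]
    rintro _ rfl
    refine Separable.of_dvd (?_ : f.Separable) (minpoly.dvd K _ hx)
    rw [separable_def]
    have : derivative f = -1 := by simp [f, derivative_X_pow]
    rw [this]
    exact isCoprime_one_right.neg_right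
  have hgal : IsGalois K N := ⟨⟩
  have hr : φ.fieldRange ≤ auxRes A hk' N := by
    refine aux_range_le p hFt φ t ht _ ?_
    refine aux_as_mem p (auxRes A hk' N).toSubfield (residue A ⟨x, hxA⟩) _ ?_ ⟨⟨x, hxA⟩, hxN, rfl⟩
    rw [← map_pow φ, ← map_sub, hta, φ.commutes, ← hyc', ← map_pow, ← map_sub]
    congr 1
    apply Subtype.ext
    show x ^ p - x = yc.1
    rw [hx1, hyc]; ring
  have hge := hFt ▸ aux_le_finrank hk hk' φ N hr
  have heq := le_antisymm hle hge
  exact ⟨N, N, le_rfl, hNfd, hgal, heq, by rw [heq]; nlinarith [hp.two_le], hr⟩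

theorem aux_binom {R S : Type*} [CommRing R] [CommRing S] (f : R →+* S) (p : ℕ) (hp : p.Prime)
    (x : R) (hx : f x = 0) : ∃ G : R, (1 + x) ^ p = 1 + x ^ p + p * x * G ∧ f G = 1 := by
  refine ⟨∑ k ∈ Finset.Ioo 0 p, x ^ (k - 1) * 1 ^ (p - k - 1) * ((p.choose k / p : ℕ) : R),
    ?_, ?_⟩
  · rw [add_comm 1 x, add_pow_prime_eq hp x 1, one_pow, mul_one, add_comm (x ^ p)]
  · simp only [one_pow, mul_one]
    rw [map_sum, Finset.sum_eq_single 1]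
    · simp [Nat.div_self hp.pos]
    · intro k hk h1
      rw [Finset.mem_Ioo] at hk
      rw [map_mul, map_pow, hx, zero_pow (by omega), zero_mul]
    · intro h
      exact absurd (Finset.mem_Ioo.mpr ⟨zero_lt_one, hp.one_lt⟩) h

/-- `x` is of the form `1 + l * a` where `a` has residue `t`. -/
def auxGood {R S : Type*} [CommRing R] [CommRing S] (f : R →+* S) (l x : R) (t : S) : Prop :=
  ∃ a, x = 1 + l * a ∧ f a = t

theorem auxGood.mul {R S : Type*} [CommRing R] [CommRing S] {f : R →+* S} {l x y : R} {s t : S}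
    (hl : f l = 0) (hx : auxGood f l x s) (hy : auxGood f l y t) :
    auxGood f l (x * y) (s + t) := by
  obtain ⟨a, rfl, rfl⟩ := hx
  obtain ⟨b, rfl, rfl⟩ := hy
  exact ⟨a + b + l * a * b, by ring, by simp [hl]⟩

theorem auxGood.one {R S : Type*} [CommRing R] [CommRing S] {f : R →+* S} {l : R} :
    auxGood f l 1 0 := ⟨0, by simp, by simp⟩

theorem auxGood.pow {R S : Type*} [CommRing R] [CommRing S] {f : R →+* S} {l x : R} {s : S}
    (hl : f l = 0) (hx : auxGood f l x s) (n : ℕ) : auxGood f l (x ^ n) (n * s) := by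
  induction n with
  | zero => simpa using auxGood.one
  | succ n ih =>
    have := ih.mul hl hx
    rw [pow_succ]
    convert this using 1
    push_cast; ring

theorem auxGood.prod {R S ι : Type*} [CommRing R] [CommRing S] {f : R →+* S} {l : R}
    (hl : f l = 0) (I : Finset ι) (x : ι → R) (s : ι → S) (h : ∀ i, auxGood f l (x i) (s i)) :
    auxGood f l (∏ i ∈ I, x i) (∑ i ∈ I, s i) := by
  classical
  induction I using Finset.induction_on with
  | empty => simpa using auxGood.one
  | insert a I ha ih =>
    rw [Finset.prod_insert ha, Finset.sum_insert ha]
    exact (h a).mul hl ih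

theorem aux_case1b {K Ω k Ft : Type*} [Field K] [Field Ω] [Algebra K Ω]
    {A : ValuationSubring Ω} [Field k] [Field Ft] [Algebra k Ft]
    [Algebra k (ResidueField A)]
    (hk : ∀ (a : K) (y : A), y.1 = algebraMap K Ω a → ∃ c : k, residue A y = algebraMap k _ c)
    (hk' : ∀ c : k, ∃ (a : K) (y : A), y.1 = algebraMap K Ω a ∧ residue A y = algebraMap k _ c)
    (φ : Ft →ₐ[k] ResidueField A)
    (p : ℕ) [Fact p.Prime] (hFt : Module.finrank k Ft = p) [IsGalois k Ft]
    [IsAlgClosure K Ω] (hpK : (p : K) ≠ 0) [CharP k p] :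
    ∃ F N : IntermediateField K Ω, F ≤ N ∧ FiniteDimensional K N ∧ IsGalois K F ∧
      Module.finrank K F = p ∧ Module.finrank K N < p * p ∧ φ.fieldRange ≤ auxRes A hk' N := by
  have hp : p.Prime := Fact.out
  have hac : IsAlgClosed Ω := IsAlgClosure.isAlgClosed K
  have : CharP (ResidueField A) p :=
    charP_of_injective_algebraMap (algebraMap k (ResidueField A)).injective p
  have hpΩ : NeZero (p : Ω) := ⟨by
    rw [← map_natCast (algebraMap K Ω), Ne, map_eq_zero]; exact hpK⟩
  obtain ⟨t, a0, ht, hta⟩ := aux_artin_schreier p hFt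
  obtain ⟨c, yc, hyc, hyc'⟩ := hk' (-a0)
  obtain ⟨ζ, hζ⟩ := HasEnoughRootsOfUnity.exists_primitiveRoot Ω p
  have hζA : ζ ∈ A := aux_root_mem A p hp.two_le 0 1 ζ (by rw [hζ.pow_eq_one]; simp)
  let z : A := ⟨ζ, hζA⟩
  have hzp : z ^ p = 1 := Subtype.ext hζ.pow_eq_one
  -- elements with p-th power residue one
  have hone : ∀ x : A, residue A (x ^ p) = 1 → residue A x = 1 := by
    intro x hx
    rw [map_pow] at hx
    have : (residue A x - 1) ^ p = 0 := by rw [sub_pow_char, hx, one_pow, sub_self]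
    exact sub_eq_zero.mp (pow_eq_zero_iff hp.ne_zero |>.mp this)
  have hz1 : residue A z = 1 := hone z (by rw [hzp, map_one])
  let l : A := z - 1
  have hl : residue A l = 0 := by simp only [l]; rw [map_sub, hz1, map_one, sub_self]
  have hl0 : l ≠ 0 := by
    intro h
    exact hζ.ne_one hp.one_lt (congrArg Subtype.val (sub_eq_zero.mp h))
  have hlp : residue A (l ^ p) = 0 := by rw [map_pow, hl, zero_pow hp.ne_zero]
  let CC : K[X] := 1 + C c * (X - 1) ^ p
  let cj : (ZMod p)ˣ → A := fun j => 1 + yc * (z ^ (j : ZMod p).val - 1) ^ p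
  have hcj : ∀ j : (ZMod p)ˣ, aeval (ζ ^ (j : ZMod p).val) CC = (cj j : Ω) := by
    intro j
    simp only [CC, cj]
    simp [hyc, z]
  let h : ZMod p →+* ResidueField A := ZMod.castHom (dvd_refl p) _
  have hval : ∀ j : ZMod p, (j.val : ResidueField A) = h j := by
    intro j
    rw [ZMod.castHom_apply, ZMod.natCast_val]
  have hgood : ∀ j, auxGood (residue A) (l ^ p) (cj j)
      (algebraMap k (ResidueField A) (-a0) * h (j : ZMod p)) := by
    intro j
    refine ⟨yc * (∑ i ∈ Finset.range (j : ZMod p).val, z ^ i) ^ p, ?_, ?_⟩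
    · simp only [cj, l]
      rw [← mul_geom_sum z, mul_pow]; ring
    · rw [map_mul, hyc', map_pow, map_sum]
      simp only [map_pow, hz1, one_pow, Finset.sum_const, Finset.card_range, nsmul_eq_mul, mul_one]
      rw [hval, ← map_pow, ZMod.pow_card]
  have hCne : ∀ j : (ZMod p)ˣ, aeval (ζ ^ (j : ZMod p).val) CC ≠ 0 := by
    intro j h0
    rw [hcj] at h0
    obtain ⟨a, ha, -⟩ := hgood j
    have h1 : residue A (cj j) = 1 := by rw [ha, map_add, map_one, map_mul, hlp]; ring
    have h2 : cj j = 0 := Subtype.ext h0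
    rw [h2, map_zero] at h1
    exact zero_ne_one h1
  let bA : A := ∏ j : (ZMod p)ˣ, cj j ^ ((j⁻¹ : (ZMod p)ˣ) : ZMod p).val
  have hbA : auxB p CC ζ = (bA : Ω) := by
    unfold auxB
    simp only [hcj, bA]
    exact (map_prod A.subtype (fun j : (ZMod p)ˣ => cj j ^ ((j⁻¹ : (ZMod p)ˣ) : ZMod p).val)
      Finset.univ).symm
  have hbgood : auxGood (residue A) (l ^ p) bA (algebraMap k (ResidueField A) a0) := by
    have := auxGood.prod hlp Finset.univ _ _
      (fun j => (hgood j).pow hlp ((j⁻¹ : (ZMod p)ˣ) : ZMod p).val)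
    convert this using 1
    have h1 : ∀ j : (ZMod p)ˣ, ((((j⁻¹ : (ZMod p)ˣ) : ZMod p).val : ℕ) : ResidueField A) *
        (algebraMap k (ResidueField A) (-a0) * h (j : ZMod p)) =
        algebraMap k (ResidueField A) (-a0) := by
      intro j
      rw [hval, mul_left_comm, ← map_mul h, Units.inv_mul, map_one, mul_one]
    rw [Finset.sum_congr rfl fun j _ => h1 j, Finset.sum_const, Finset.card_univ,
      ZMod.card_units, nsmul_eq_mul, Nat.cast_sub hp.one_le, CharP.cast_eq_zero]
    simp
  obtain ⟨a, hba, ha⟩ := hbgood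
  obtain ⟨β, hβ⟩ := IsAlgClosed.exists_pow_nat_eq (auxB p CC ζ) hp.pos
  have hβA : β ∈ A := aux_root_mem A p hp.two_le 0 bA β (by rw [hβ, hbA]; simp)
  let m : A := ⟨β, hβA⟩ - 1
  have hm1 : (1 + m) ^ p = 1 + l ^ p * a := by
    rw [← hba]; apply Subtype.ext
    rw [← hbA, ← hβ]; simp [m]
  have hm : residue A m = 0 := by
    have : residue A (1 + m) = 1 := hone _ (by rw [hm1, map_add, map_mul, hlp]; simp)
    rw [map_add, map_one] at this
    simpa using this
  obtain ⟨g, hg, hg1⟩ := aux_binom (residue A) p hp l hl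
  obtain ⟨g', hg', hg1'⟩ := aux_binom (residue A) p hp m hm
  have e1 : (p : A) * g = - l ^ (p - 1) := by
    have h1 : (1 + l) ^ p = 1 := by simp only [l]; rw [add_sub_cancel, hzp]
    have h2 : l * ((p : A) * g + l ^ (p - 1)) = 0 := by
      rw [mul_add, ← pow_succ', Nat.sub_add_cancel hp.one_le]
      linear_combination h1 - hg
    have h3 := (mul_eq_zero.mp h2).resolve_left hl0
    linear_combination h3
  have e2 : g * m ^ p - l ^ (p - 1) * m * g' = l ^ p * a * g := by
    linear_combination g * (hm1 - hg') - m * g' * e1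
  have hgu : IsUnit g := by
    by_contra hu
    have := (residue_eq_zero_iff g).mpr hu
    rw [hg1] at this
    exact one_ne_zero this
  obtain ⟨gi, hgi⟩ := hgu.exists_left_inv
  have hgi1 : residue A gi = 1 := by
    have := congrArg (residue A) hgi
    rwa [map_mul, hg1, mul_one, map_one] at this
  let w : Ω := (m : Ω) / (l : Ω)
  have hlΩ : (l : Ω) ≠ 0 := fun h => hl0 (Subtype.ext h)
  have hmw : (m : Ω) = l * w := by simp only [w]; field_simp
  have hgiΩ : (gi : Ω) * g = 1 := congrArg Subtype.val hgi
  have hw : w ^ p = ((gi * g' : A) : Ω) * w + a := by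
    have h1 : (g : Ω) * (m : Ω) ^ p - (l : Ω) ^ (p - 1) * m * g' = (l : Ω) ^ p * a * g :=
      congrArg Subtype.val e2
    have h2 : (l : Ω) ^ p = l ^ (p - 1) * l := by
      rw [← pow_succ, Nat.sub_add_cancel hp.one_le]
    have h3 : (l : Ω) ^ p * (g * w ^ p - w * g' - a * g) = 0 := by
      rw [hmw, mul_pow] at h1
      linear_combination h1 - w * g' * h2
    have h4 := (mul_eq_zero.mp h3).resolve_left (pow_ne_zero _ hlΩ)
    show w ^ p = (gi : Ω) * g' * w + a
    linear_combination gi * h4 + (a - w ^ p) * hgiΩ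
  have hwA : w ∈ A := aux_root_mem A p hp.two_le _ _ w hw
  refine aux_finish_kummer hk hk' φ p hFt hpK CC ζ β hζ hCne hβ ?_
  set N := IntermediateField.adjoin K {ζ, β}
  have hζN : ζ ∈ N := IntermediateField.subset_adjoin _ _ (by simp)
  have hβN : β ∈ N := IntermediateField.subset_adjoin _ _ (by simp)
  have hwN : w ∈ N := div_mem (sub_mem hβN (one_mem _)) (sub_mem hζN (one_mem _))
  refine aux_range_le p hFt φ t ht _ ?_
  refine aux_as_mem p (auxRes A hk' N).toSubfield (residue A ⟨w, hwA⟩) _ ?_ ⟨⟨w, hwA⟩, hwN, rfl⟩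
  rw [← map_pow φ, ← map_sub, hta, φ.commutes, ← ha]
  have h5 : (⟨w, hwA⟩ : A) ^ p = gi * g' * ⟨w, hwA⟩ + a := Subtype.ext hw
  rw [← map_pow, h5, map_add, map_mul, map_mul, hgi1, hg1']
  ring

/-- The Lagrange resolvent. -/
def auxL {k Ft κ : Type*} [Field k] [Field Ft] [Field κ] [Algebra k Ft] [Algebra k κ]
    (p : ℕ) (φ : Ft →ₐ[k] κ) (σ : Gal(Ft/k)) (η : κ) (x : Ft) : κ :=
  ∑ i ∈ Finset.range p, η ^ i * φ ((σ ^ i) x)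

theorem auxL_twist {k Ft κ : Type*} [Field k] [Field Ft] [Field κ] [Algebra k Ft] [Algebra k κ]
    (p : ℕ) (φ : Ft →ₐ[k] κ) (σ : Gal(Ft/k)) (hσ : σ ^ p = 1) (η : κ) (hη : η ^ p = 1) (x : Ft) :
    η * auxL p φ σ η (σ x) = auxL p φ σ η x := by
  unfold auxL
  have h1 : η * ∑ i ∈ Finset.range p, η ^ i * φ ((σ ^ i) (σ x)) =
      ∑ i ∈ Finset.range p, η ^ (i + 1) * φ ((σ ^ (i + 1)) x) := by
    rw [Finset.mul_sum]
    refine Finset.sum_congr rfl fun i _ => ?_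
    rw [pow_succ σ, AlgEquiv.mul_apply]; ring
  rw [h1]
  have h2 := Finset.sum_range_succ (fun i => η ^ i * φ ((σ ^ i) x)) p
  rw [Finset.sum_range_succ'] at h2
  rw [hσ, hη] at h2
  simpa using h2

theorem auxL_twist_pow {k Ft κ : Type*} [Field k] [Field Ft] [Field κ] [Algebra k Ft]
    [Algebra k κ] (p : ℕ) (φ : Ft →ₐ[k] κ) (σ : Gal(Ft/k)) (hσ : σ ^ p = 1) (η : κ)
    (hη : η ^ p = 1) (x : Ft) (l : ℕ) :
    η ^ l * auxL p φ σ η ((σ ^ l) x) = auxL p φ σ η x := by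
  induction l with
  | zero => simp
  | succ l ih =>
    rw [pow_succ' σ, AlgEquiv.mul_apply, pow_succ η, mul_assoc, auxL_twist p φ σ hσ η hη, ih]

theorem aux_average {k Ft κ : Type*} [Field k] [Field Ft] [Field κ] [Algebra k Ft] [Algebra k κ]
    (p : ℕ) [Fact p.Prime] (hFt : Module.finrank k Ft = p) [IsGalois k Ft] (hpk : (p : k) ≠ 0)
    (φ : Ft →ₐ[k] κ) (P : Ft[X]) :
    ∃ c : k[X], ∀ x : κ,
      (∀ τ : Gal(Ft/k), eval₂ (φ : Ft →+* κ) x (P.map (τ : Ft →+* Ft)) =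
        eval₂ (φ : Ft →+* κ) x P) →
      aeval x c = eval₂ (φ : Ft →+* κ) x P := by
  classical
  have hp : p.Prime := Fact.out
  have hfd : FiniteDimensional k Ft :=
    FiniteDimensional.of_finrank_pos (by rw [hFt]; exact hp.pos)
  have hcard : Nat.card Gal(Ft/k) = p := by rw [IsGalois.card_aut_eq_finrank, hFt]
  let Q : Ft[X] := ∑ τ : Gal(Ft/k), P.map (τ : Ft →+* Ft)
  have hQ : Q ∈ lifts (algebraMap k Ft) := by
    rw [lifts_iff_coeff_lifts]
    intro n
    refine ⟨Algebra.trace k Ft (P.coeff n), ?_⟩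
    rw [trace_eq_sum_automorphisms]
    simp only [Q, finsetSum_coeff, coeff_map]
    rfl
  obtain ⟨c, hc⟩ := hQ
  refine ⟨Polynomial.C ((p : k)⁻¹) * c, fun x hx => ?_⟩
  have h1 : aeval x c = eval₂ (φ : Ft →+* κ) x Q := by
    rw [← hc, coe_mapRingHom, eval₂_map, aeval_def]
    congr 1
    exact φ.comp_algebraMap.symm
  have h2 : eval₂ (φ : Ft →+* κ) x Q = p * eval₂ (φ : Ft →+* κ) x P := by
    simp only [Q]
    rw [eval₂_finsetSum, Finset.sum_congr rfl fun τ _ => hx τ, Finset.sum_const,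
      Finset.card_univ, ← Nat.card_eq_fintype_card, hcard, nsmul_eq_mul]
  rw [map_mul, aeval_C, h1, h2, ← mul_assoc, ← map_natCast (algebraMap k κ), ← map_mul,
    inv_mul_cancel₀ hpk, map_one, one_mul]

theorem aux_resolvent {k Ft κ : Type*} [Field k] [Field Ft] [Field κ] [Algebra k Ft]
    [Algebra k κ] (p : ℕ) [Fact p.Prime] (hFt : Module.finrank k Ft = p) [IsGalois k Ft]
    (hpk : (p : k) ≠ 0) (φ : Ft →ₐ[k] κ) (ξ : κ) (hξ : IsPrimitiveRoot ξ p) :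
    ∃ (c : k[X]) (ρ : ℕ → κ) (t : Ft), (∀ d : k, algebraMap k Ft d ≠ t) ∧
      (∀ j, ρ j ≠ 0) ∧ (∀ j, aeval (ξ ^ j) c = ρ j ^ p) ∧
      ∀ D : IntermediateField k κ, ξ ∈ D → (∀ j n, p ∣ j + n → ρ j * ρ 1 ^ n ∈ D) ∧
        (ρ 1 ∈ D → φ t ∈ D) := by
  classical
  have hp : p.Prime := Fact.out
  have hfd : FiniteDimensional k Ft :=
    FiniteDimensional.of_finrank_pos (by rw [hFt]; exact hp.pos)
  obtain ⟨σ, hord, hpow, hfix⟩ := aux_generator p hFt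
  have hσ : σ ^ p = 1 := by rw [← hord, pow_orderOf_eq_one]
  let B := IsGalois.normalBasis k Ft
  let t : Ft := B 1
  have hBt : ∀ τ : Gal(Ft/k), B τ = τ t := fun τ => IsGalois.normalBasis_apply τ
  have hξj : ∀ j, (ξ ^ j) ^ p = 1 := fun j => by
    rw [← pow_mul, mul_comm, pow_mul, hξ.pow_eq_one, one_pow]
  let ρ : ℕ → κ := fun j => auxL p φ σ (ξ ^ j) t
  have hξ0 : ξ ≠ 0 := hξ.ne_zero hp.ne_zero
  have hρ0 : ∀ j, ρ j ≠ 0 := by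
    intro j hj
    have h0 : ∀ τ : Gal(Ft/k), auxL p φ σ (ξ ^ j) (τ t) = 0 := by
      intro τ
      obtain ⟨l, -, rfl⟩ := hpow τ
      have := auxL_twist_pow p φ σ hσ (ξ ^ j) (hξj j) t l
      rw [show auxL p φ σ (ξ ^ j) t = 0 from hj] at this
      exact (mul_eq_zero.mp this).resolve_left (pow_ne_zero _ (pow_ne_zero _ hξ0))
    let Lj : Ft →ₗ[k] κ := ∑ i ∈ Finset.range p, (ξ ^ j) ^ i •
      (φ.comp (σ ^ i : Gal(Ft/k)).toAlgHom).toLinearMap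
    have hLj : ∀ x, Lj x = auxL p φ σ (ξ ^ j) x := by
      intro x
      simp [Lj, auxL]
    have hL0 : Lj = 0 := by
      refine B.ext fun τ => ?_
      rw [hLj, hBt, h0]; rfl
    -- Dedekind
    let g : Fin p → (Ft →* κ) := fun i =>
      ((φ.comp (σ ^ (i : ℕ) : Gal(Ft/k)).toAlgHom : Ft →ₐ[k] κ) : Ft →* κ)
    have hg : Function.Injective g := by
      intro a b hab
      have h1 : σ ^ (a : ℕ) = σ ^ (b : ℕ) := by
        refine AlgEquiv.ext fun x => φ.injective ?_
        exact DFunLike.congr_fun hab x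
      exact Fin.ext (pow_injOn_Iio_orderOf (by simp [hord]) (by simp [hord]) h1)
    have hli := (linearIndependent_monoidHom Ft κ).comp g hg
    rw [Fintype.linearIndependent_iff] at hli
    have := hli (fun i => (ξ ^ j) ^ (i : ℕ)) (by
      funext x
      have h2 := hLj x
      rw [hL0] at h2
      have h3 : auxL p φ σ (ξ ^ j) x = 0 := h2.symm
      unfold auxL at h3
      rw [Finset.sum_range] at h3
      simpa [g] using h3) ⟨0, hp.pos⟩
    simp at this
  have ht : ∀ d : k, algebraMap k Ft d ≠ t := by
    intro d hd
    apply hρ0 1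
    simp only [ρ, auxL]
    rw [← hd]
    simp only [AlgEquiv.commutes, pow_one]
    rw [← Finset.sum_mul, hξ.geom_sum_eq_zero hp.one_lt, zero_mul]
  let R : Ft[X] := ∑ i ∈ Finset.range p, Polynomial.C ((σ ^ i) t) * X ^ i
  have hR : ∀ (l : ℕ) (η : κ),
      eval₂ (φ : Ft →+* κ) η (R.map ((σ ^ l : Gal(Ft/k)) : Ft →+* Ft)) =
        auxL p φ σ η ((σ ^ l) t) := by
    intro l η
    simp only [R, auxL]
    rw [Polynomial.map_sum, eval₂_finsetSum]
    refine Finset.sum_congr rfl fun i _ => ?_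
    simp only [Polynomial.map_mul, map_C, Polynomial.map_pow, map_X, eval₂_mul, eval₂_C,
      eval₂_pow, eval₂_X]
    rw [mul_comm]
    congr 1
    show φ ((σ ^ l) ((σ ^ i) t)) = φ ((σ ^ i) ((σ ^ l) t))
    rw [← AlgEquiv.mul_apply, ← AlgEquiv.mul_apply, ← pow_add, ← pow_add, add_comm]
  have hR1 : ∀ (η : κ), eval₂ (φ : Ft →+* κ) η R = auxL p φ σ η t := by
    intro η
    have := hR 0 η
    rw [pow_zero] at this
    rw [AlgEquiv.one_apply] at this
    rw [← this]
    congr 1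
    exact (Polynomial.map_id).symm
  obtain ⟨c, hc⟩ := aux_average p hFt hpk φ (R ^ p)
  refine ⟨c, ρ, t, ht, hρ0, fun j => ?_, fun D hξD => ?_⟩
  · rw [hc, eval₂_pow, hR1]
    intro τ
    obtain ⟨l, -, rfl⟩ := hpow τ
    rw [Polynomial.map_pow, eval₂_pow, eval₂_pow, hR, hR1,
      ← auxL_twist_pow p φ σ hσ (ξ ^ j) (hξj j) t l, mul_pow, ← pow_mul, mul_comm l, pow_mul,
      hξj, one_pow, one_mul]
  have hA : ∀ j n, p ∣ j + n → ρ j * ρ 1 ^ n ∈ D := by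
    intro j n hjn
    obtain ⟨c', hc'⟩ := aux_average p hFt hpk φ (R.comp (X ^ j) * R ^ n)
    have h1 := hc' ξ (by
      intro τ
      obtain ⟨l, -, rfl⟩ := hpow τ
      simp only [Polynomial.map_mul, Polynomial.map_pow, Polynomial.map_comp, map_X,
        eval₂_mul, eval₂_comp, eval₂_pow, eval₂_X, hR, hR1]
      rw [← auxL_twist_pow p φ σ hσ (ξ ^ j) (hξj j) t l,
        ← auxL_twist_pow p φ σ hσ ξ hξ.pow_eq_one t l]
      have h2 : (ξ ^ j) ^ l * (ξ ^ l) ^ n = 1 := by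
        obtain ⟨q, hq⟩ := hjn
        rw [← pow_mul, ← pow_mul, ← pow_add, show j * l + l * n = (j + n) * l by ring, hq,
          mul_assoc, pow_mul, hξ.pow_eq_one, one_pow]
      linear_combination (-(auxL p φ σ (ξ ^ j) ((σ ^ l) t) * auxL p φ σ ξ ((σ ^ l) t) ^ n)) * h2)
    simp only [eval₂_mul, eval₂_comp, eval₂_pow, eval₂_X, hR1] at h1
    have h3 : ρ j * ρ 1 ^ n = aeval ξ c' := by
      rw [h1]; simp only [ρ, pow_one]
    rw [h3]
    have := (aeval (⟨ξ, hξD⟩ : D) c').2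
    rwa [← IntermediateField.coe_val, ← aeval_algHom_apply] at this
  refine ⟨hA, fun h1 => ?_⟩
  have hall : ∀ j < p, ρ j ∈ D := by
    intro j hj
    have h2 := hA j (p - j) (by rw [Nat.add_sub_cancel' hj.le])
    have h3 : ρ j = ρ j * ρ 1 ^ (p - j) / ρ 1 ^ (p - j) := by
      rw [mul_div_cancel_right₀ _ (pow_ne_zero _ (hρ0 1))]
    rw [h3]
    exact div_mem h2 (pow_mem h1 _)
  have hsum : ∑ j ∈ Finset.range p, ρ j = p * φ t := by
    simp only [ρ, auxL]
    rw [Finset.sum_comm, Finset.sum_eq_single 0]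
    · simp
    · intro i hi hi0
      rw [Finset.mem_range] at hi
      rw [← Finset.sum_mul]
      have hcop : i.Coprime p := Nat.Coprime.symm ((hp.coprime_iff_not_dvd).mpr fun h => by
        have := Nat.le_of_dvd (Nat.pos_of_ne_zero hi0) h; omega)
      have h4 := (hξ.pow_of_coprime i hcop).geom_sum_eq_zero hp.one_lt
      have h5 : ∑ j ∈ Finset.range p, (ξ ^ j) ^ i = 0 := by
        rw [← h4]
        exact Finset.sum_congr rfl fun j _ => by rw [← pow_mul, ← pow_mul, mul_comm]
      rw [h5, zero_mul]
    · intro h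
      exact absurd (Finset.mem_range.mpr hp.pos) h
  have hpκ : (p : κ) ≠ 0 := by
    rw [← map_natCast (algebraMap k κ), Ne, map_eq_zero]; exact hpk
  have h6 : φ t = (∑ j ∈ Finset.range p, ρ j) / (p : κ) := by
    rw [hsum, mul_div_cancel_left₀ _ hpκ]
  rw [h6]
  exact div_mem (sum_mem fun j hj => hall j (Finset.mem_range.mp hj)) (natCast_mem D p)

theorem aux_lift_poly {K Ω k : Type*} [Field K] [Field Ω] [Algebra K Ω]
    {A : ValuationSubring Ω} [Field k] [Algebra k (ResidueField A)]
    (hk' : ∀ c : k, ∃ (a : K) (y : A), y.1 = algebraMap K Ω a ∧ residue A y = algebraMap k _ c)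
    (c : k[X]) : ∃ C : K[X], ∀ y : A, ∃ w : A, aeval y.1 C = w.1 ∧
      residue A w = aeval (residue A y) c := by
  induction c using Polynomial.induction_on' with
  | add f g hf hg =>
    obtain ⟨F, hF⟩ := hf
    obtain ⟨G, hG⟩ := hg
    refine ⟨F + G, fun y => ?_⟩
    obtain ⟨w, hw, hw'⟩ := hF y
    obtain ⟨v, hv, hv'⟩ := hG y
    exact ⟨w + v, by rw [map_add, hw, hv]; rfl, by rw [map_add, map_add, hw', hv']⟩
  | monomial n a =>
    obtain ⟨b, y0, h1, h2⟩ := hk' a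
    refine ⟨monomial n b, fun y => ⟨y0 * y ^ n, ?_, ?_⟩⟩
    · rw [aeval_monomial, ← h1]; rfl
    · rw [aeval_monomial, map_mul, map_pow, h2]

theorem aux_case2 {K Ω k Ft : Type*} [Field K] [Field Ω] [Algebra K Ω]
    {A : ValuationSubring Ω} [Field k] [Field Ft] [Algebra k Ft]
    [Algebra k (ResidueField A)]
    (hk : ∀ (a : K) (y : A), y.1 = algebraMap K Ω a → ∃ c : k, residue A y = algebraMap k _ c)
    (hk' : ∀ c : k, ∃ (a : K) (y : A), y.1 = algebraMap K Ω a ∧ residue A y = algebraMap k _ c)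
    (φ : Ft →ₐ[k] ResidueField A)
    (p : ℕ) [Fact p.Prime] (hFt : Module.finrank k Ft = p) [IsGalois k Ft]
    [IsAlgClosure K Ω] (hpK : (p : K) ≠ 0) (hpk : (p : k) ≠ 0) :
    ∃ F N : IntermediateField K Ω, F ≤ N ∧ FiniteDimensional K N ∧ IsGalois K F ∧
      Module.finrank K F = p ∧ Module.finrank K N < p * p ∧ φ.fieldRange ≤ auxRes A hk' N := by
  have hp : p.Prime := Fact.out
  have hac : IsAlgClosed Ω := IsAlgClosure.isAlgClosed K
  have hpΩ : NeZero (p : Ω) := ⟨by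
    rw [← map_natCast (algebraMap K Ω), Ne, map_eq_zero]; exact hpK⟩
  obtain ⟨ζ, hζ⟩ := HasEnoughRootsOfUnity.exists_primitiveRoot Ω p
  have hζA : ζ ∈ A := aux_root_mem A p hp.two_le 0 1 ζ (by rw [hζ.pow_eq_one]; simp)
  let z : A := ⟨ζ, hζA⟩
  have hzp : z ^ p = 1 := Subtype.ext hζ.pow_eq_one
  have hz : IsPrimitiveRoot z p := IsPrimitiveRoot.of_map_of_injective (f := A.subtype)
    hζ A.subtype_injective
  have hξ : IsPrimitiveRoot (residue A z) p := by
    have h1 : residue A z ≠ 1 := by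
      intro h
      have h2 := congrArg (residue A) (hz.geom_sum_eq_zero hp.one_lt)
      rw [map_sum, map_zero] at h2
      simp only [map_pow, h, one_pow, Finset.sum_const, Finset.card_range, nsmul_eq_mul,
        mul_one] at h2
      rw [← map_natCast (algebraMap k (ResidueField A)), map_eq_zero] at h2
      exact hpk h2
    have h2 : orderOf (residue A z) = p :=
      orderOf_eq_prime (by rw [← map_pow, hzp, map_one]) h1
    have h3 := IsPrimitiveRoot.orderOf (residue A z)
    rwa [h2] at h3
  obtain ⟨c, ρ, t, ht, hρ0, hρ, hD⟩ := aux_resolvent p hFt hpk φ _ hξ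
  obtain ⟨CC, hCC⟩ := aux_lift_poly hk' c
  choose w hw hw' using fun j : (ZMod p)ˣ => hCC (z ^ (j : ZMod p).val)
  have hw1 : ∀ j : (ZMod p)ˣ, aeval (ζ ^ (j : ZMod p).val) CC = (w j : Ω) := fun j => hw j
  have hw2 : ∀ j : (ZMod p)ˣ, residue A (w j) = ρ (j : ZMod p).val ^ p := by
    intro j
    rw [hw', map_pow, hρ]
  have hCne : ∀ j : (ZMod p)ˣ, aeval (ζ ^ (j : ZMod p).val) CC ≠ 0 := by
    intro j h0
    rw [hw1] at h0
    have h2 : w j = 0 := Subtype.ext h0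
    have h1 := hw2 j
    rw [h2, map_zero] at h1
    exact pow_ne_zero _ (hρ0 _) h1.symm
  let e : (ZMod p)ˣ → ℕ := fun j => ((j⁻¹ : (ZMod p)ˣ) : ZMod p).val
  let bA : A := ∏ j : (ZMod p)ˣ, w j ^ e j
  have hbA : auxB p CC ζ = (bA : Ω) := by
    unfold auxB
    simp only [hw1, bA]
    exact (map_prod A.subtype (fun j : (ZMod p)ˣ => w j ^ e j) Finset.univ).symm
  obtain ⟨β, hβ⟩ := IsAlgClosed.exists_pow_nat_eq (auxB p CC ζ) hp.pos
  have hβA : β ∈ A := aux_root_mem A p hp.two_le 0 bA β (by rw [hβ, hbA]; simp)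
  let b : A := ⟨β, hβA⟩
  have hb : b ^ p = bA := Subtype.ext (by rw [← hbA, ← hβ]; rfl)
  let r : ResidueField A := ∏ j : (ZMod p)ˣ, ρ (j : ZMod p).val ^ e j
  have hr0 : r ≠ 0 := Finset.prod_ne_zero_iff.mpr fun j _ => pow_ne_zero _ (hρ0 _)
  have hbr : residue A b ^ p = r ^ p := by
    rw [← map_pow, hb]
    simp only [bA, r]
    rw [map_prod, ← Finset.prod_pow]
    refine Finset.prod_congr rfl fun j _ => ?_
    rw [map_pow, hw2, ← pow_mul, ← pow_mul, mul_comm]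
  obtain ⟨i, -, hi⟩ := hξ.eq_pow_of_pow_eq_one (ξ := residue A b / r) (by
    rw [div_pow, hbr, div_self (pow_ne_zero _ hr0)])
  refine aux_finish_kummer hk hk' φ p hFt hpK CC ζ β hζ hCne hβ ?_
  set N := IntermediateField.adjoin K {ζ, β}
  have hζN : ζ ∈ N := IntermediateField.subset_adjoin _ _ (by simp)
  have hβN : β ∈ N := IntermediateField.subset_adjoin _ _ (by simp)
  have hξD : residue A z ∈ auxRes A hk' N := ⟨z, hζN, rfl⟩
  have hbD : residue A b ∈ auxRes A hk' N := ⟨b, hβN, rfl⟩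
  have hξ0 : residue A z ≠ 0 := hξ.ne_zero hp.ne_zero
  have hrD : r ∈ auxRes A hk' N := by
    have : r = residue A b / residue A z ^ i := by
      rw [hi, div_div_cancel₀]
      intro h
      rw [h, zero_pow hp.ne_zero] at hbr
      exact pow_ne_zero _ hr0 hbr.symm
    rw [this]
    exact div_mem hbD (pow_mem hξD _)
  obtain ⟨hA, hfin⟩ := hD _ hξD
  refine aux_range_le p hFt φ t ht _ (hfin ?_)
  let n : (ZMod p)ˣ → ℕ := fun j => p - (j : ZMod p).val
  have hprod : ∏ j : (ZMod p)ˣ, (ρ (j : ZMod p).val * ρ 1 ^ n j) ^ e j ∈ auxRes A hk' N := by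
    refine prod_mem fun j _ => pow_mem (hA _ _ ?_) _
    rw [Nat.add_sub_cancel' (ZMod.val_lt _).le]
  let M : ℕ := ∑ j : (ZMod p)ˣ, n j * e j
  have hprod2 : ∏ j : (ZMod p)ˣ, (ρ (j : ZMod p).val * ρ 1 ^ n j) ^ e j = r * ρ 1 ^ M := by
    simp only [r, M]
    rw [← Finset.prod_pow_eq_pow_sum, ← Finset.prod_mul_distrib]
    refine Finset.prod_congr rfl fun j _ => ?_
    rw [mul_pow, ← pow_mul]
  have hM : ρ 1 ^ M ∈ auxRes A hk' N := by
    have : ρ 1 ^ M = r * ρ 1 ^ M / r := by rw [mul_div_cancel_left₀ _ hr0]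
    rw [this, ← hprod2]
    exact div_mem hprod hrD
  have hMp : M % p = 1 := by
    have h1 : (M : ZMod p) = 1 := by
      simp only [M]
      rw [Nat.cast_sum]
      have h2 : ∀ j : (ZMod p)ˣ, ((n j * e j : ℕ) : ZMod p) = -1 := by
        intro j
        simp only [n, e]
        rw [Nat.cast_mul, Nat.cast_sub (ZMod.val_lt _).le, ZMod.natCast_zmod_val,
          ZMod.natCast_zmod_val, CharP.cast_eq_zero, zero_sub, neg_mul, Units.mul_inv]
      rw [Finset.sum_congr rfl fun j _ => h2 j, Finset.sum_const, Finset.card_univ,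
        ZMod.card_units, nsmul_eq_mul, Nat.cast_sub hp.one_le, CharP.cast_eq_zero]
      simp
    have h3 : (M : ZMod p) = (1 : ℕ) := by rw [h1, Nat.cast_one]
    rw [ZMod.natCast_eq_natCast_iff', Nat.mod_eq_of_lt hp.one_lt] at h3
    exact h3
  have hp1 : ρ 1 ^ p ∈ auxRes A hk' N := by
    have := hA 1 (p - 1) (by rw [Nat.add_sub_cancel' hp.one_le])
    rwa [← pow_succ', Nat.sub_add_cancel hp.one_le] at this
  have h4 : ρ 1 = ρ 1 ^ M / (ρ 1 ^ p) ^ (M / p) := by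
    rw [eq_div_iff (pow_ne_zero _ (pow_ne_zero _ (hρ0 1))), ← pow_mul, ← pow_succ']
    congr 1
    have := Nat.div_add_mod M p
    omega
  rw [h4]
  exact div_mem hM (pow_mem hp1 _)

theorem aux_emb (k Ft κ : Type*) [Field k] [Field Ft] [Field κ] [Algebra k Ft] [Algebra k κ]
    [FiniteDimensional k Ft] [IsAlgClosed κ] : Nonempty (Ft →ₐ[k] κ) :=
  ⟨IsAlgClosed.lift⟩

end

/-- Let (K, v) be a p-Henselian valued field and F̃ a degree-p extension
of the residue field K̂ inside K̂(p). Then F̃ has an inertial lift in K(p) over K: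
there is F ⊆ K(p) with [F : K] = p, v extends uniquely to F, and the residue field
of this extension is K̂-isomorphic to F̃ (in particular [F̂ : K̂] = p). -/
theorem statement4 (p : ℕ) [Fact p.Prime] (K : Type*) [Field K]
    (O : ValuationSubring K) (hO : PHenselian p O)
    (Ft : IntermediateField (IsLocalRing.ResidueField O)
      (pClosure p (IsLocalRing.ResidueField O)))
    (hFt : Module.finrank (IsLocalRing.ResidueField O) Ft = p) :
    ∃ F : IntermediateField K (pClosure p K), Module.finrank K F = p ∧
      ∃ OF : ValuationSubring F, OF.comap (algebraMap K F) = O ∧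
        (∀ OF' : ValuationSubring F, OF'.comap (algebraMap K F) = O → OF' = OF) ∧
        ∃ e : IsLocalRing.ResidueField OF ≃+* Ft,
          ∀ (x : O) (y : OF), y.1 = algebraMap K F (x : K) →
            e (IsLocalRing.residue OF y) =
              algebraMap (IsLocalRing.ResidueField O) Ft (IsLocalRing.residue O x) := by
  classical
  have hp : p.Prime := Fact.out
  obtain ⟨A, hA⟩ := aux_exists_ext (Ω := AlgebraicClosure K) O
  have hmem : ∀ x : K, x ∈ O ↔ algebraMap K (AlgebraicClosure K) x ∈ A := by
    intro x
    rw [← ValuationSubring.mem_comap, hA]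
  let f : O →+* A :=
    ((algebraMap K (AlgebraicClosure K)).comp O.subtype).codRestrict A.toSubring
      (fun x => (hmem x.1).mp x.2)
  have hf : IsLocalHom f := by
    constructor
    intro x hx
    have hx0 : x.1 ≠ 0 := by
      intro h
      have h1 : x = 0 := Subtype.ext h
      rw [h1, map_zero] at hx
      exact not_isUnit_zero hx
    obtain ⟨y, hy⟩ := hx.exists_right_inv
    have hy1 : algebraMap K (AlgebraicClosure K) x.1 * y.1 = 1 := congrArg Subtype.val hy
    have hinv : x.1⁻¹ ∈ O := by
      rw [hmem, map_inv₀, ← eq_inv_of_mul_eq_one_right hy1]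
      exact y.2
    exact IsUnit.of_mul_eq_one ⟨x.1⁻¹, hinv⟩ (Subtype.ext (mul_inv_cancel₀ hx0))
  letI : Algebra (IsLocalRing.ResidueField O) (IsLocalRing.ResidueField A) :=
    (IsLocalRing.ResidueField.map f).toAlgebra
  have hk : ∀ (x : O) (y : A), y.1 = algebraMap K _ x.1 →
      IsLocalRing.residue A y = algebraMap (IsLocalRing.ResidueField O) (IsLocalRing.ResidueField A) (IsLocalRing.residue O x) := by
    intro x y h
    have : y = f x := Subtype.ext h
    rw [this]
    exact (IsLocalRing.ResidueField.map_residue f x).symm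
  have hk' : ∀ c : IsLocalRing.ResidueField O, ∃ (a : K) (y : A),
      y.1 = algebraMap K _ a ∧ IsLocalRing.residue A y = algebraMap (IsLocalRing.ResidueField O) _ c := by
    intro c
    obtain ⟨x, rfl⟩ := IsLocalRing.residue_surjective c
    exact ⟨x.1, f x, rfl, hk x (f x) rfl⟩
  have hk0 : ∀ (a : K) (y : A), y.1 = algebraMap K _ a →
      ∃ c : IsLocalRing.ResidueField O, IsLocalRing.residue A y = algebraMap (IsLocalRing.ResidueField O) _ c := by
    intro a y h
    have ha : a ∈ O := (hmem a).mpr (h ▸ y.2)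
    exact ⟨IsLocalRing.residue O ⟨a, ha⟩, hk ⟨a, ha⟩ y h⟩
  have hgal : IsGalois (IsLocalRing.ResidueField O) Ft := aux_isGalois_of_finrank p Ft hFt
  have hfd : FiniteDimensional (IsLocalRing.ResidueField O) Ft :=
    FiniteDimensional.of_finrank_pos (by rw [hFt]; exact hp.pos)
  have hac : IsAlgClosed (IsLocalRing.ResidueField A) := aux_algClosed A
  obtain ⟨φ⟩ := aux_emb (IsLocalRing.ResidueField O) Ft (IsLocalRing.ResidueField A)
  obtain ⟨F, N, h1, h2, h3, h4, h5, h6⟩ : ∃ F N : IntermediateField K (AlgebraicClosure K),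
      F ≤ N ∧ FiniteDimensional K N ∧ IsGalois K F ∧
      Module.finrank K F = p ∧ Module.finrank K N < p * p ∧ φ.fieldRange ≤ auxRes A hk' N := by
    by_cases hpk : (p : IsLocalRing.ResidueField O) = 0
    · have : CharP (IsLocalRing.ResidueField O) p := (CharP.charP_iff_prime_eq_zero hp).mpr hpk
      by_cases hpK : (p : K) = 0
      · have : CharP K p := (CharP.charP_iff_prime_eq_zero hp).mpr hpK
        exact aux_case1a hk0 hk' φ p hFt
      · exact aux_case1b hk0 hk' φ p hFt hpK
    · refine aux_case2 hk0 hk' φ p hFt ?_ hpk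
      intro h
      apply hpk
      have h1 : (p : O) = 0 := Subtype.ext (by simpa using h)
      have h2 := congrArg (IsLocalRing.residue O) h1
      simpa using h2
  exact aux_assembly p K O hO Ft hFt A hA hk hk' φ F N h1 h4 h5 h6
end

section
/- Let (K, v) be a valued field with char(K) = p and v(K) ≠ p·v(K). Then K has infinitely many distinct totally ramified degree-p cyclic extensions inside K(p); in particular, the rank r(p)_K of G(K(p)/K) is infinite. Specifically, if π ∈ K* satisfies v(π) > 0 and v(π) ∉ p·v(K), then the polynomials f_n(X) = X^p − X − π^{−(1+pn)}, n ∈ N, are irreducible over K and their root fields are pairwise distinct totally ramified degree-p extensions of K. -/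
/-- Two nonzero elements of a valued field have the same value for the valuation
with valuation subring `O` iff each divides the other in `O`. -/
def ValEq {L : Type*} [Field L] (O : ValuationSubring L) (a b : L) : Prop :=
  a / b ∈ O ∧ b / a ∈ O

/-- `z` lies in the maximal ideal of `O`, i.e. has (additively written) positive value. -/
def InMax {L : Type*} [Field L] (O : ValuationSubring L) (z : L) : Prop :=
  z ∈ O ∧ z⁻¹ ∉ O

/-- The residue field extension of `O'/O` is trivial: every element of `O'` is
congruent, modulo the maximal ideal of `O'`, to an element of `O`. -/
def ResidueTrivial {K L : Type*} [Field K] [Field L] [Algebra K L]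
    (O : ValuationSubring K) (O' : ValuationSubring L) : Prop :=
  ∀ y : L, y ∈ O' → ∃ x : K, x ∈ O ∧
    (y - algebraMap K L x = 0 ∨ InMax O' (y - algebraMap K L x))

/-- The ramification index of `O'` over the base field `K` is `e`: the quotient
of value groups v'(L*)/v(K*) has a transversal of exactly `e` elements. -/
def RamIndexEq (e : ℕ) {K L : Type*} [Field K] [Field L] [Algebra K L]
    (O' : ValuationSubring L) : Prop :=
  ∃ u : Fin e → L, (∀ i, u i ≠ 0) ∧
    (∀ i j, i ≠ j → ∀ x : K, x ≠ 0 → ¬ ValEq O' (u i / u j) (algebraMap K L x)) ∧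
    (∀ y : L, y ≠ 0 → ∃ i, ∃ x : K, x ≠ 0 ∧ ValEq O' y (u i * algebraMap K L x))

namespace ASProof

open Polynomial

/-- The valuation-theoretic core: `w θ ^ p` is not in the image of `p`-th powers. -/
lemma val_root {L : Type*} [Field L] {Γ : Type*} [LinearOrderedCommGroupWithZero Γ]
    (w : Valuation L Γ) (p : ℕ) (hp : p.Prime) (θ b : L) (hb : 1 < w b)
    (h : θ ^ p - θ = b) : w θ ^ p = w b := by
  have h1 : 1 < w θ := by
    by_contra hle
    push Not at hle
    have : w (θ ^ p - θ) ≤ 1 := by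
      refine (w.map_sub _ _).trans (max_le ?_ hle)
      rw [map_pow]
      exact pow_le_one' hle p
    rw [h] at this
    exact absurd hb (not_lt.mpr this)
  have h2 : w θ < w (θ ^ p) := by
    rw [map_pow]
    calc w θ = w θ ^ 1 := (pow_one _).symm
      _ < w θ ^ p := pow_lt_pow_right₀ h1 hp.one_lt
  rw [← h, w.map_sub_eq_of_lt_left h2, map_pow]

lemma no_root {K : Type*} [Field K] {Γ : Type*} [LinearOrderedCommGroupWithZero Γ]
    (v : Valuation K Γ) (p : ℕ) (hp : p.Prime) (π : K) (hπ0 : π ≠ 0) (hπ1 : v π < 1)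
    (hπ : ∀ x : K, x ≠ 0 → v π ≠ v x ^ p) (m : ℕ) (b α : K)
    (hb : v b = v (π⁻¹ ^ (1 + p * m))) (h : α ^ p - α = b) : False := by
  have hv0 : v π ≠ 0 := (v.ne_zero_iff).mpr hπ0
  have hi : 1 < v π⁻¹ := by
    rw [map_inv₀]
    exact (one_lt_inv₀ (zero_lt_iff.mpr hv0)).mpr hπ1
  have hb1 : 1 < v b := by
    rw [hb, map_pow]
    exact one_lt_pow₀ hi (by omega)
  have h3 := val_root v p hp α b hb1 h
  have hα : α ≠ 0 := by
    rintro rfl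
    rw [map_zero, zero_pow hp.ne_zero] at h3
    rw [← h3] at hb1
    exact absurd hb1 (not_lt.mpr zero_le_one)
  refine hπ (α * π ^ m)⁻¹ (inv_ne_zero (mul_ne_zero hα (pow_ne_zero _ hπ0))) ?_
  rw [map_inv₀, map_mul, map_pow, inv_pow, mul_pow, h3, hb, map_pow, map_inv₀, ← pow_mul]
  rw [pow_add, pow_one, mul_comm m p, inv_pow]
  field_simp

lemma sep_values {K L : Type*} [Field K] [Field L] [Algebra K L] {Γ : Type*}
    [LinearOrderedCommGroupWithZero Γ]
    (w : Valuation L Γ) (p : ℕ) (hp : p.Prime) (π : K) (hπ0 : π ≠ 0)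
    (hπ : ∀ x : K, x ≠ 0 → w (algebraMap K L π) ≠ w (algebraMap K L x) ^ p) (n : ℕ) (θ : L)
    (hθ : w θ ^ p = (w (algebraMap K L π))⁻¹ ^ (1 + p * n))
    (k : ℤ) (hk : ¬ (p : ℤ) ∣ k) (x : K) (hx : x ≠ 0) : w θ ^ k ≠ w (algebraMap K L x) := by
  intro h
  set P := w (algebraMap K L π) with hP
  set Y := w (algebraMap K L x) with hY
  have hP0 : P ≠ 0 := (w.ne_zero_iff).mpr (by simpa using hπ0)
  have hpi : Prime (p : ℤ) := Nat.prime_iff_prime_int.mp hp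
  have h1 : Y ^ (p : ℤ) = P ^ (-(1 + p * n : ℤ) * k) := by
    rw [← h, ← zpow_mul, mul_comm k, zpow_mul, zpow_natCast, hθ, zpow_mul, zpow_neg]
    congr 1
    rw [inv_pow]
    norm_cast
  have hnd : ¬ (p : ℤ) ∣ (-(1 + p * n : ℤ) * k) := by
    intro hd
    rcases hpi.dvd_or_dvd hd with h2 | h2
    · rw [dvd_neg, dvd_add_left (dvd_mul_right _ _)] at h2
      exact hpi.not_dvd_one h2
    · exact hk h2
  have hc : IsCoprime (p : ℤ) (-(1 + p * n : ℤ) * k) :=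
    (Prime.coprime_iff_not_dvd hpi).mpr hnd
  obtain ⟨t, s, hts⟩ := hc
  refine hπ (x ^ s * π ^ t) (mul_ne_zero (zpow_ne_zero _ hx) (zpow_ne_zero _ hπ0)) ?_
  rw [map_mul, map_zpow₀, map_zpow₀, map_mul, map_zpow₀, map_zpow₀, ← hP, ← hY,
    mul_pow, ← zpow_natCast, ← zpow_natCast, ← zpow_mul, ← zpow_mul, mul_comm s, zpow_mul, h1,
    ← zpow_mul, ← zpow_add₀ hP0]
  conv_lhs => rw [← zpow_one P]
  congr 1
  linear_combination -hts

lemma poly_monic {K : Type*} [Field K] (p : ℕ) (hp : p.Prime) (a : K) :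
    (X ^ p - X - C a : K[X]).Monic ∧ (X ^ p - X - C a : K[X]).natDegree = p := by
  have h1 : (X + C a : K[X]).degree < p := by
    rw [degree_X_add_C]
    exact_mod_cast hp.one_lt
  rw [sub_sub]
  have hm := monic_X_pow_sub (n := p) h1
  refine ⟨hm, ?_⟩
  apply natDegree_eq_of_degree_eq_some
  rw [degree_sub_eq_left_of_degree_lt (by rwa [degree_X_pow]), degree_X_pow]

lemma irred {K : Type*} [Field K] (p : ℕ) [Fact p.Prime] [CharP K p] (a : K)
    (h : ∀ (d : ℕ) (s : K), ¬ p ∣ d → s ^ p - s ≠ d * a) :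
    Irreducible (X ^ p - X - C a : K[X]) := by
  have hp : p.Prime := Fact.out
  obtain ⟨hm, hd⟩ := poly_monic p hp a
  rw [hm.irreducible_iff_natDegree']
  refine ⟨fun h1 => ?_, ?_⟩
  · rw [h1, natDegree_one] at hd
    exact hp.ne_zero hd.symm
  · intro f g hf hg hfg hmem
    rw [hd, Finset.mem_Ioc] at hmem
    obtain ⟨h0, h2⟩ := hmem
    have hlt : g.natDegree < p := lt_of_le_of_lt h2 (Nat.div_lt_self hp.pos (by norm_num))
    let A := AlgebraicClosure K
    haveI : CharP A p := charP_of_injective_algebraMap (algebraMap K A).injective p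
    have hs : (g.map (algebraMap K A)).Splits := IsAlgClosed.splits _
    have hn := hs.nextCoeff_eq_neg_sum_roots_of_monic (hg.map _)
    have hcard := splits_iff_card_roots.mp hs
    rw [natDegree_map] at hcard
    have key : ∀ s : Multiset A, (∀ r ∈ s, r ^ p - r = algebraMap K A a) →
        s.sum ^ p - s.sum = (s.card : A) * algebraMap K A a := by
      intro s
      induction s using Multiset.induction_on with
      | empty => intro _; simp [hp.ne_zero]
      | cons r s ih =>
        intro hr
        have h1 := hr r (Multiset.mem_cons_self _ _)
        have h2 := ih (fun t ht => hr t (Multiset.mem_cons_of_mem ht))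
        rw [Multiset.sum_cons, add_pow_char, Multiset.card_cons, Nat.cast_succ]
        linear_combination h1 + h2
    have hroots : ∀ r ∈ (g.map (algebraMap K A)).roots, r ^ p - r = algebraMap K A a := by
      intro r hr
      have hr' : aeval r g = 0 := by
        rw [mem_roots', IsRoot.def, eval_map_algebraMap] at hr
        exact hr.2
      have : aeval r (X ^ p - X - C a : K[X]) = 0 := by
        rw [← hfg, map_mul, hr', mul_zero]
      simpa [sub_eq_zero] using this
    have hk := key _ hroots
    rw [hcard] at hk
    have hsum : (g.map (algebraMap K A)).roots.sum = algebraMap K A (-g.nextCoeff) := by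
      rw [map_neg, ← nextCoeff_map (algebraMap K A).injective, hn, neg_neg]
    rw [hsum] at hk
    refine h g.natDegree (-g.nextCoeff) (Nat.not_dvd_of_pos_of_lt h0 hlt) ?_
    apply (algebraMap K A).injective
    simpa using hk

lemma repr {K L : Type*} [Field K] [Field L] [Algebra K L] (p : ℕ) (hp : p.Prime) (a : K)
    (hirr : Irreducible (X ^ p - X - C a : K[X])) (hfin : Module.finrank K L = p)
    (θ : L) (hθ : θ ^ p - θ = algebraMap K L a) (y : L) :
    ∃ c : Fin p → K, y = ∑ i, algebraMap K L (c i) * θ ^ (i : ℕ) := by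
  obtain ⟨hm, hd⟩ := poly_monic p hp a
  have hmin : X ^ p - X - C a = minpoly K θ :=
    minpoly.eq_of_irreducible_of_monic hirr (by simp [hθ]) hm
  have hli := linearIndependent_pow (K := K) θ
  rw [← hmin, hd] at hli
  haveI : Nonempty (Fin p) := ⟨⟨0, hp.pos⟩⟩
  let B := basisOfLinearIndependentOfCardEqFinrank hli (by simp [hfin])
  refine ⟨fun i => B.repr y i, ?_⟩
  conv_lhs => rw [← B.sum_repr y]
  refine Finset.sum_congr rfl fun i _ => ?_
  rw [Algebra.smul_def]
  simp [B]

lemma prime_elt {L : Type*} [Field L] (p : ℕ) [Fact p.Prime] [CharP L p] (x : L)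
    (hx : x ^ p = x) : ∃ k : ℕ, x = k := by
  letI := ZMod.algebra L p
  have h := (Subfield.mem_bot_iff_pow_eq_self L p).mpr hx
  rw [Subfield.bot_eq_of_zMod_algebra p] at h
  obtain ⟨z, hz⟩ := h
  refine ⟨z.val, ?_⟩
  rw [← hz, ← map_natCast (algebraMap (ZMod p) L), ZMod.natCast_zmod_val]

lemma nat_pow {L : Type*} [Field L] (p : ℕ) [Fact p.Prime] [CharP L p] (k : ℕ) :
    (k : L) ^ p = k := by
  have := map_natCast (frobenius L p) k
  rwa [frobenius_def] at this

lemma galois {K L : Type*} [Field K] [Field L] [Algebra K L] (p : ℕ) [Fact p.Prime] [CharP K p]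
    (a : K) (hirr : Irreducible (X ^ p - X - C a : K[X])) (hfin : Module.finrank K L = p)
    (θ : L) (hθ : θ ^ p - θ = algebraMap K L a) : IsGalois K L := by
  have hp : p.Prime := Fact.out
  haveI : CharP L p := charP_of_injective_algebraMap (algebraMap K L).injective p
  obtain ⟨hm, hd⟩ := poly_monic p hp a
  have hsep : (X ^ p - X - C a : K[X]).Separable := by
    rw [separable_def]
    simp only [derivative_sub, derivative_X_pow, derivative_X, derivative_C, CharP.cast_eq_zero]
    simp only [map_zero, zero_mul, zero_sub, sub_zero]
    exact (isCoprime_one_right).neg_right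
  have hne : (X ^ p - X - C a : K[X]).map (algebraMap K L) ≠ 0 := (hm.map _).ne_zero
  have hroot : ∀ k : ℕ, θ + k ∈ ((X ^ p - X - C a : K[X]).map (algebraMap K L)).roots := by
    intro k
    rw [mem_roots hne, IsRoot.def]
    simp only [Polynomial.map_sub, Polynomial.map_pow, map_X, map_C, eval_sub, eval_pow, eval_X,
      eval_C]
    rw [add_pow_char, nat_pow, ← hθ]
    ring
  have hsplit : ((X ^ p - X - C a : K[X]).map (algebraMap K L)).Splits := by
    rw [splits_iff_card_roots]
    apply le_antisymm (card_roots' _)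
    rw [natDegree_map, hd]
    classical
    have hinj : Set.InjOn (fun k : ℕ => θ + (k : L)) (Finset.range p) := by
      intro i hi j hj hij
      have h1 : (i : L) = j := add_left_cancel hij
      rw [CharP.cast_eq_iff_mod_eq L p] at h1
      simp only [Finset.coe_range, Set.mem_Iio] at hi hj
      rwa [Nat.mod_eq_of_lt hi, Nat.mod_eq_of_lt hj] at h1
    have hc := Finset.card_image_of_injOn hinj
    rw [Finset.card_range] at hc
    refine hc.ge.trans ?_
    refine le_trans (Finset.card_le_card ?_) (Multiset.toFinset_card_le _)
    intro z hz
    obtain ⟨k, -, rfl⟩ := Finset.mem_image.mp hz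
    exact Multiset.mem_toFinset.mpr (hroot k)
  haveI : IsSplittingField K L (X ^ p - X - C a : K[X]) := by
    refine ⟨hsplit, ?_⟩
    rw [eq_top_iff]
    rintro y -
    obtain ⟨c, rfl⟩ := repr p hp a hirr hfin θ hθ y
    refine Subalgebra.sum_mem _ fun i _ => Subalgebra.mul_mem _ (Subalgebra.algebraMap_mem _ _)
      (Subalgebra.pow_mem _ (Algebra.subset_adjoin ?_) _)
    rw [mem_rootSet]
    exact ⟨hm.ne_zero, by simp [hθ]⟩
  exact IsGalois.of_separable_splitting_field hsep

lemma as_rel {K L : Type*} [Field K] [Field L] [Algebra K L] (p : ℕ) [Fact p.Prime] [CharP K p]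
    (a b : K) (hirr : Irreducible (X ^ p - X - C a : K[X])) (hfin : Module.finrank K L = p)
    (θ : L) (hθ : θ ^ p - θ = algebraMap K L a) (η : L) (hη : η ^ p - η = algebraMap K L b) :
    ∃ (k : ℕ) (β : K), β ^ p - β = b - k * a := by
  have hp : p.Prime := Fact.out
  haveI : CharP L p := charP_of_injective_algebraMap (algebraMap K L).injective p
  haveI := galois p a hirr hfin θ hθ
  haveI : FiniteDimensional K L := Module.finite_of_finrank_pos (hfin ▸ hp.pos)
  have hcard : Nat.card Gal(L/K) = p := by rw [IsGalois.card_aut_eq_finrank, hfin]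
  haveI : Nontrivial Gal(L/K) := by
    rw [← Finite.one_lt_card_iff_nontrivial, hcard]
    exact hp.one_lt
  obtain ⟨σ, hσ⟩ := exists_ne (1 : Gal(L/K))
  have hdiff : ∀ (t : L) (u : K), t ^ p - t = algebraMap K L u → (σ t - t) ^ p = σ t - t := by
    intro t u ht
    have h1 := congrArg σ ht
    rw [map_sub, map_pow, AlgEquiv.commutes] at h1
    rw [sub_pow_char]
    linear_combination h1 - ht
  have hc := hdiff θ a hθ
  have hd := hdiff η b hη
  set c := σ θ - θ with hcdef
  set d := σ η - η with hddef
  have hc0 : c ≠ 0 := by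
    intro h0
    have hfix : σ θ = θ := sub_eq_zero.mp h0
    apply hσ
    ext y
    obtain ⟨q, rfl⟩ := repr p hp a hirr hfin θ hθ y
    simp [hfix]
  obtain ⟨k, hk⟩ := prime_elt p (d / c) (by rw [div_pow, hc, hd])
  have hdk : d = k * c := by rw [← hk]; field_simp
  have hfix : σ (η - k * θ) = η - k * θ := by
    rw [map_sub, map_mul, map_natCast]
    have e1 : σ η = η + d := by rw [hddef]; ring
    have e2 : σ θ = θ + c := by rw [hcdef]; ring
    rw [e1, e2, hdk]
    ring
  have hall : ∀ τ : Gal(L/K), τ (η - k * θ) = η - k * θ := by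
    intro τ
    have hτ : τ ∈ Subgroup.zpowers σ := mem_zpowers_of_prime_card hcard hσ
    have hle : Subgroup.zpowers σ ≤ MulAction.stabilizer Gal(L/K) (η - k * θ) := by
      rw [Subgroup.zpowers_le, MulAction.mem_stabilizer_iff]
      exact hfix
    exact MulAction.mem_stabilizer_iff.mp (hle hτ)
  obtain ⟨β, hβ⟩ := (IsGalois.mem_range_algebraMap_iff_fixed (F := K) (η - k * θ)).mpr hall
  refine ⟨k, β, (algebraMap K L).injective ?_⟩
  rw [map_sub, map_pow, hβ, map_sub, map_mul, map_natCast, ← hθ, ← hη, sub_pow_char, mul_pow,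
    nat_pow]
  ring

lemma dominate {K L : Type*} [Field K] [Field L] [Algebra K L] {Γ : Type*}
    [LinearOrderedCommGroupWithZero Γ]
    (w : Valuation L Γ) (p : ℕ) (hp : p.Prime) (θ : L) (hθ0 : θ ≠ 0)
    (hsep : ∀ k : ℤ, ¬ (p : ℤ) ∣ k → ∀ x : K, x ≠ 0 → w θ ^ k ≠ w (algebraMap K L x))
    (c : Fin p → K) (hc : ∃ i, c i ≠ 0) :
    ∃ i, c i ≠ 0 ∧ w (∑ j, algebraMap K L (c j) * θ ^ (j : ℕ)) =
        w (algebraMap K L (c i) * θ ^ (i : ℕ)) := by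
  classical
  haveI : Nonempty (Fin p) := ⟨⟨0, hp.pos⟩⟩
  obtain ⟨i, -, hi⟩ := Finset.exists_max_image (Finset.univ : Finset (Fin p))
    (fun j => w (algebraMap K L (c j) * θ ^ (j : ℕ))) Finset.univ_nonempty
  have hw0 : w θ ≠ 0 := (w.ne_zero_iff).mpr hθ0
  have hci : c i ≠ 0 := by
    intro h0
    obtain ⟨j, hj⟩ := hc
    have h1 := hi j (Finset.mem_univ _)
    simp only [h0, map_zero, zero_mul] at h1
    have h2 := (w.zero_iff).mp (le_zero_iff.mp h1)
    exact mul_ne_zero (by simpa using hj) (pow_ne_zero _ hθ0) h2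
  refine ⟨i, hci, ?_⟩
  apply w.map_sum_eq_of_lt (f := fun j : Fin p => algebraMap K L (c j) * θ ^ (j : ℕ))
    (Finset.mem_univ i)
  intro j hj
  refine lt_of_le_of_ne (hi j (Finset.mem_univ _)) ?_
  have hji : j ≠ i := by simpa using hj
  intro heq
  by_cases hcj : c j = 0
  · simp only [hcj, map_zero, zero_mul] at heq
    exact mul_ne_zero (by simpa using hci) (pow_ne_zero _ hθ0) ((w.zero_iff).mp heq.symm)
  have hnd : ¬ (p : ℤ) ∣ ((j : ℕ) : ℤ) - ((i : ℕ) : ℤ) := by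
    intro hd
    have hb := Int.eq_zero_of_abs_lt_dvd hd (by
      rw [abs_lt]; have := i.2; have := j.2; constructor <;> omega)
    exact hji (Fin.ext (by omega))
  refine hsep _ hnd (c i / c j) (div_ne_zero hci hcj) ?_
  have hwj : w (algebraMap K L (c j)) ≠ 0 := (w.ne_zero_iff).mpr (by simpa using hcj)
  rw [zpow_sub₀ hw0, zpow_natCast, zpow_natCast, map_div₀, map_div₀]
  rw [div_eq_div_iff (pow_ne_zero _ hw0) hwj]
  simp only [map_mul, map_pow] at heq
  rw [mul_comm, heq]

lemma valEq_iff {L : Type*} [Field L] (O : ValuationSubring L) {a b : L} (ha : a ≠ 0)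
    (hb : b ≠ 0) : ValEq O a b ↔ O.valuation a = O.valuation b := by
  have ha' : 0 < O.valuation a := zero_lt_iff.mpr ((O.valuation.ne_zero_iff).mpr ha)
  have hb' : 0 < O.valuation b := zero_lt_iff.mpr ((O.valuation.ne_zero_iff).mpr hb)
  rw [ValEq, ← O.valuation_le_one_iff, ← O.valuation_le_one_iff, map_div₀, map_div₀,
    div_le_one₀ hb', div_le_one₀ ha', le_antisymm_iff]

lemma inMax_iff {L : Type*} [Field L] (O : ValuationSubring L) {a : L} :
    InMax O a ↔ a ≠ 0 ∧ O.valuation a < 1 := by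
  by_cases ha : a = 0
  · subst ha
    simp [InMax, O.zero_mem]
  have ha' : 0 < O.valuation a := zero_lt_iff.mpr ((O.valuation.ne_zero_iff).mpr ha)
  rw [InMax, ← O.valuation_le_one_iff, ← O.valuation_le_one_iff, map_inv₀, inv_le_one₀ ha', not_le]
  exact ⟨fun h => ⟨ha, h.2⟩, fun h => ⟨h.2.le, h.2⟩⟩

lemma ram {K L : Type*} [Field K] [Field L] [Algebra K L] (p : ℕ) [Fact p.Prime]
    (O : ValuationSubring K) (π : K) (hπpos : InMax O π)
    (hπ : ∀ x : K, x ≠ 0 → ¬ ValEq O π (x ^ p)) (n : ℕ)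
    (hirr : Irreducible (X ^ p - X - C (π⁻¹ ^ (1 + p * n)) : K[X]))
    (hfin : Module.finrank K L = p)
    (θ : L) (hθ : θ ^ p - θ = algebraMap K L (π⁻¹ ^ (1 + p * n)))
    (O' : ValuationSubring L) (hO : O'.comap (algebraMap K L) = O) :
    ResidueTrivial O O' ∧ RamIndexEq p (K := K) O' := by
  have hp : p.Prime := Fact.out
  have hπ0 : π ≠ 0 := ((inMax_iff O).mp hπpos).1
  have hmem : ∀ x : K, x ∈ O ↔ algebraMap K L x ∈ O' := by
    intro x
    rw [← hO, ValuationSubring.mem_comap]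
  set w := O'.valuation with hw
  have hπ1 : w (algebraMap K L π) < 1 := by
    refine ((inMax_iff O').mp ⟨(hmem _).mp hπpos.1, ?_⟩).2
    rw [← map_inv₀, ← hmem]
    exact hπpos.2
  have hπ' : ∀ x : K, x ≠ 0 → w (algebraMap K L π) ≠ w (algebraMap K L x) ^ p := by
    intro x hx h
    rw [← map_pow, ← valEq_iff O' (by simpa using hπ0)
      (pow_ne_zero _ (by simpa using hx))] at h
    refine hπ x hx ⟨?_, ?_⟩
    · rw [hmem]; simpa using h.1
    · rw [hmem]; simpa using h.2
  have hv0 : w (algebraMap K L π) ≠ 0 := (w.ne_zero_iff).mpr (by simpa using hπ0)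
  have hval : w (algebraMap K L (π⁻¹ ^ (1 + p * n))) =
      (w (algebraMap K L π))⁻¹ ^ (1 + p * n) := by
    rw [map_pow, map_pow, map_inv₀, map_inv₀]
  have hθp : w θ ^ p = (w (algebraMap K L π))⁻¹ ^ (1 + p * n) := by
    rw [← hval]
    refine val_root w p hp θ _ ?_ hθ
    rw [hval]
    exact one_lt_pow₀ ((one_lt_inv₀ (zero_lt_iff.mpr hv0)).mpr hπ1) (by omega)
  have hθ0 : θ ≠ 0 := by
    rintro rfl
    rw [map_zero, zero_pow hp.ne_zero] at hθp
    exact pow_ne_zero _ (inv_ne_zero hv0) hθp.symm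
  have hw0 : w θ ≠ 0 := (w.ne_zero_iff).mpr hθ0
  have hsep : ∀ k : ℤ, ¬ (p : ℤ) ∣ k → ∀ x : K, x ≠ 0 → w θ ^ k ≠ w (algebraMap K L x) :=
    fun k hk x hx => sep_values w p hp π hπ0 hπ' n θ hθp k hk x hx
  have hdom := dominate (K := K) w p hp θ hθ0 hsep
  have hndvd : ∀ i j : Fin p, i ≠ j → ¬ (p : ℤ) ∣ ((i : ℕ) : ℤ) - ((j : ℕ) : ℤ) := by
    intro i j hij hd
    have hb := Int.eq_zero_of_abs_lt_dvd hd (by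
      rw [abs_lt]; have := i.2; have := j.2; constructor <;> omega)
    exact hij (Fin.ext (by omega))
  constructor
  · intro y hy
    obtain ⟨c, hc⟩ := repr p hp _ hirr hfin θ hθ y
    let z : Fin p := ⟨0, hp.pos⟩
    -- the tail of the expansion has value different from one
    have hy' : y - algebraMap K L (c z) =
        ∑ j, algebraMap K L (Function.update c z 0 j) * θ ^ (j : ℕ) := by
      classical
      rw [hc, ← Finset.add_sum_erase _ _ (Finset.mem_univ z),
        ← Finset.add_sum_erase (Finset.univ : Finset (Fin p))
          (fun j => algebraMap K L (Function.update c z 0 j) * θ ^ (j : ℕ)) (Finset.mem_univ z)]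
      have : ∑ j ∈ Finset.univ.erase z, algebraMap K L (Function.update c z 0 j) * θ ^ (j : ℕ)
          = ∑ j ∈ Finset.univ.erase z, algebraMap K L (c j) * θ ^ (j : ℕ) := by
        refine Finset.sum_congr rfl fun j hj => ?_
        rw [Function.update_of_ne (Finset.ne_of_mem_erase hj)]
      rw [this]
      simp [z]
    by_cases hz : y - algebraMap K L (c z) = 0
    · refine ⟨c z, ?_, Or.inl hz⟩
      rw [hmem, ← sub_eq_zero.mp hz]
      exact hy
    have hex : ∃ i, Function.update c z 0 i ≠ 0 := by
      by_contra hcon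
      push Not at hcon
      exact hz (by rw [hy']; simp [hcon])
    obtain ⟨i, hi0, hi⟩ := hdom _ hex
    rw [← hy'] at hi
    have hiz : i ≠ z := by
      rintro rfl
      simp at hi0
    rw [Function.update_of_ne hiz] at hi hi0
    have hci : w (algebraMap K L (c i)) ≠ 0 := (w.ne_zero_iff).mpr (by simpa using hi0)
    -- comparison of the value of the tail with values of `K`
    have hneK : ∀ x : K, x ≠ 0 → w (y - algebraMap K L (c z)) ≠ w (algebraMap K L x) := by
      intro x hx h
      have h1 := hndvd i z hiz
      refine hsep _ h1 (x / c i) (div_ne_zero hx hi0) ?_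
      rw [hi, map_mul, map_pow] at h
      rw [map_div₀, map_div₀, ← h]
      simp only [z, Nat.cast_zero, sub_zero, zpow_natCast]
      field_simp
    have hy1 : w y ≤ 1 := (O'.valuation_le_one_iff y).mpr hy
    have hlt : w (y - algebraMap K L (c z)) < 1 := by
      have hne1 : w (y - algebraMap K L (c z)) ≠ 1 := by
        simpa using hneK 1 one_ne_zero
      refine lt_of_le_of_ne ?_ hne1
      by_contra hgt
      push Not at hgt
      have hlt2 : w y < w (y - algebraMap K L (c z)) := lt_of_le_of_lt hy1 hgt
      have h3 : w (y - (y - algebraMap K L (c z))) = w (y - algebraMap K L (c z)) :=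
        w.map_sub_eq_of_lt_right hlt2
      rw [sub_sub_cancel] at h3
      by_cases hcz : c z = 0
      · rw [hcz, map_zero, map_zero, sub_zero] at h3
        rw [← hw] at *
        rw [hcz, map_zero, sub_zero] at hlt2
        exact lt_irrefl _ hlt2
      · exact hneK _ hcz h3.symm
    refine ⟨c z, ?_, Or.inr ((inMax_iff O').mpr ⟨hz, hlt⟩)⟩
    rw [hmem, ← O'.valuation_le_one_iff]
    have h4 : algebraMap K L (c z) = y - (y - algebraMap K L (c z)) := by ring
    rw [h4]
    exact (w.map_sub _ _).trans (max_le hy1 hlt.le)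
  · refine ⟨fun i => θ ^ (i : ℕ), fun i => pow_ne_zero _ hθ0, ?_, ?_⟩
    · intro i j hij x hx h
      rw [valEq_iff O' (div_ne_zero (pow_ne_zero _ hθ0) (pow_ne_zero _ hθ0))
        (by simpa using hx)] at h
      refine hsep _ (hndvd i j hij) x hx ?_
      rw [zpow_sub₀ hw0, zpow_natCast, zpow_natCast, ← h, map_div₀, map_pow, map_pow]
    · intro y hy
      obtain ⟨c, hc⟩ := repr p hp _ hirr hfin θ hθ y
      have hex : ∃ i, c i ≠ 0 := by
        by_contra hcon
        push Not at hcon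
        exact hy (by rw [hc]; simp [hcon])
      obtain ⟨i, hi0, hi⟩ := hdom c hex
      refine ⟨i, c i, hi0, ?_⟩
      rw [valEq_iff O' hy (mul_ne_zero (pow_ne_zero _ hθ0) (by simpa using hi0)), mul_comm, ← hi,
        ← hc]

lemma main_irred {K : Type*} [Field K] (p : ℕ) [Fact p.Prime] [CharP K p]
    (O : ValuationSubring K) (π : K) (hπpos : InMax O π)
    (hπ : ∀ x : K, x ≠ 0 → ¬ ValEq O π (x ^ p)) :
    (∀ n : ℕ, Irreducible (X ^ p - X - C (π⁻¹ ^ (1 + p * n)) : K[X])) ∧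
    ∀ n m : ℕ, n < m → ∀ (k : ℕ) (β : K),
      β ^ p - β ≠ π⁻¹ ^ (1 + p * m) - k * π⁻¹ ^ (1 + p * n) := by
  have hp : p.Prime := Fact.out
  obtain ⟨hπ0, hπ1⟩ := (inMax_iff O).mp hπpos
  have hπ' : ∀ x : K, x ≠ 0 → O.valuation π ≠ O.valuation x ^ p := by
    intro x hx h
    rw [← map_pow, ← valEq_iff O hπ0 (pow_ne_zero _ hx)] at h
    exact hπ x hx h
  have hv0 : O.valuation π ≠ 0 := (O.valuation.ne_zero_iff).mpr hπ0
  have hi : 1 < O.valuation π⁻¹ := by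
    rw [map_inv₀]
    exact (one_lt_inv₀ (zero_lt_iff.mpr hv0)).mpr hπ1
  have hnat : ∀ k : ℕ, O.valuation (k : K) ≤ 1 := fun k =>
    (O.valuation_le_one_iff _).mpr (natCast_mem O k)
  constructor
  · intro n
    refine irred p _ fun d s hd h => ?_
    refine no_root O.valuation p hp π hπ0 hπ1 hπ' n _ s ?_ h
    have hd0 : (d : K) ≠ 0 := by rwa [Ne, CharP.cast_eq_zero_iff K p]
    have h1 : O.valuation (d : K) ^ p = O.valuation (d : K) := by rw [← map_pow, nat_pow]
    have h2 : O.valuation (d : K) = 1 := by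
      have h3 : O.valuation (d : K) ≠ 0 := (O.valuation.ne_zero_iff).mpr hd0
      by_contra hne
      have hlt := lt_of_le_of_ne (hnat d) hne
      have := pow_lt_pow_right_of_lt_one₀ (zero_lt_iff.mpr h3) hlt hp.one_lt
      rw [pow_one, h1] at this
      exact lt_irrefl _ this
    rw [map_mul, h2, one_mul]
  · intro n m hnm k β h
    refine no_root O.valuation p hp π hπ0 hπ1 hπ' m _ β ?_ h
    apply Valuation.map_sub_eq_of_lt_left
    rw [map_mul, map_pow, map_pow]
    calc O.valuation (k : K) * O.valuation π⁻¹ ^ (1 + p * n)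
        ≤ 1 * O.valuation π⁻¹ ^ (1 + p * n) := mul_le_mul_left (hnat k) _
      _ = O.valuation π⁻¹ ^ (1 + p * n) := one_mul _
      _ < O.valuation π⁻¹ ^ (1 + p * m) := by
        apply pow_lt_pow_right₀ hi
        have := Nat.mul_lt_mul_of_pos_left hnm hp.pos
        omega

lemma adjoin_finrank {K L : Type*} [Field K] [Field L] [Algebra K L] (p : ℕ) (hp : p.Prime) (a : K)
    (hirr : Irreducible (X ^ p - X - C a : K[X]))
    (θ : L) (hθ : θ ^ p - θ = algebraMap K L a) :
    Module.finrank K (IntermediateField.adjoin K {θ}) = p := by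
  obtain ⟨hm, hd⟩ := poly_monic p hp a
  have h0 : aeval θ (X ^ p - X - C a : K[X]) = 0 := by simp [hθ]
  rw [IntermediateField.adjoin.finrank ⟨_, hm, h0⟩,
    ← minpoly.eq_of_irreducible_of_monic hirr h0 hm, hd]

end ASProof

/-- Let (K, v) be a valued field with char(K) = p and v(K) ≠ p·v(K);
say π ∈ K* has v(π) > 0 and v(π) ∉ p·v(K). Then the Artin–Schreier polynomials
f_n = X^p − X − π^{−(1+pn)} are irreducible over K and their root fields form
infinitely many pairwise distinct degree-p (totally ramified) extensions of K inside
K(p); in particular r(p)_K is infinite. -/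
theorem statement6 (p : ℕ) [Fact p.Prime] (K : Type*) [Field K] [CharP K p]
    (O : ValuationSubring K) (π : K)
    (hπpos : InMax O π)
    (hπ : ∀ x : K, x ≠ 0 → ¬ ValEq O π (x ^ p)) :
    (∀ n : ℕ, Irreducible
      ((Polynomial.X : Polynomial K) ^ p - Polynomial.X -
        Polynomial.C (π⁻¹ ^ (1 + p * n)))) ∧
    (∃ Lf : ℕ → IntermediateField K (pClosure p K), Function.Injective Lf ∧
      ∀ n : ℕ, Module.finrank K (Lf n) = p ∧
        (∃ θ : Lf n, Polynomial.aeval θ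
          ((Polynomial.X : Polynomial K) ^ p - Polynomial.X -
            Polynomial.C (π⁻¹ ^ (1 + p * n))) = 0) ∧
        ∀ O' : ValuationSubring (Lf n), O'.comap (algebraMap K (Lf n)) = O →
          ResidueTrivial O O' ∧ RamIndexEq p (K := K) O') ∧
    {L : IntermediateField K (pClosure p K) | Module.finrank K L = p}.Infinite := by
  have hp : p.Prime := Fact.out
  obtain ⟨hirr, hrel⟩ := ASProof.main_irred p O π hπpos hπ
  have hex : ∀ n : ℕ, ∃ θ : pClosure p K,
      θ ^ p - θ = algebraMap K (pClosure p K) (π⁻¹ ^ (1 + p * n)) := by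
    intro n
    obtain ⟨hm, hd⟩ := ASProof.poly_monic p hp (π⁻¹ ^ (1 + p * n))
    obtain ⟨t, ht⟩ := IsAlgClosed.exists_aeval_eq_zero (AlgebraicClosure K) _
      (hirr n).degree_pos.ne'
    have ht' : t ^ p - t = algebraMap K (AlgebraicClosure K) (π⁻¹ ^ (1 + p * n)) := by
      simpa [sub_eq_zero] using ht
    have hfin := ASProof.adjoin_finrank p hp _ (hirr n) t ht'
    have htm : t ∈ IntermediateField.adjoin K {t} := IntermediateField.mem_adjoin_simple_self K t
    have hgal := ASProof.galois (L := IntermediateField.adjoin K {t}) p _ (hirr n) hfin ⟨t, htm⟩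
      (Subtype.ext ht')
    have hle : IntermediateField.adjoin K {t} ≤ pClosure p K := by
      refine le_iSup₂_of_le (IntermediateField.adjoin K {t}) ?_ le_rfl
      exact ⟨Module.finite_of_finrank_pos (hfin ▸ hp.pos), hgal, 1, by rw [hfin, pow_one]⟩
    exact ⟨⟨t, hle htm⟩, Subtype.ext ht'⟩
  choose θ hθ using hex
  let Lf : ℕ → IntermediateField K (pClosure p K) := fun n => IntermediateField.adjoin K {θ n}
  have hmemL : ∀ n, θ n ∈ Lf n := fun n => IntermediateField.mem_adjoin_simple_self K (θ n)
  have hfin : ∀ n, Module.finrank K (Lf n) = p := fun n =>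
    ASProof.adjoin_finrank p hp _ (hirr n) (θ n) (hθ n)
  have hlt : ∀ n m, n < m → Lf n ≠ Lf m := by
    intro n m hnm h
    have h1 : θ m ∈ Lf n := h ▸ hmemL m
    obtain ⟨k, β, hβ⟩ := ASProof.as_rel (L := Lf n) p _ (π⁻¹ ^ (1 + p * m)) (hirr n)
      (hfin n) ⟨θ n, hmemL n⟩
      (Subtype.ext (hθ n)) ⟨θ m, h1⟩ (Subtype.ext (hθ m))
    exact hrel n m hnm k β hβ
  have hinj : Function.Injective Lf := by
    intro n m h
    rcases lt_trichotomy n m with h1 | h1 | h1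
    · exact absurd h (hlt n m h1)
    · exact h1
    · exact absurd h.symm (hlt m n h1)
  refine ⟨hirr, ⟨Lf, hinj, fun n => ⟨hfin n, ⟨⟨θ n, hmemL n⟩, ?_⟩, ?_⟩⟩, ?_⟩
  · have h2 : (⟨θ n, hmemL n⟩ : Lf n) ^ p - ⟨θ n, hmemL n⟩ =
        algebraMap K (Lf n) (π⁻¹ ^ (1 + p * n)) := Subtype.ext (hθ n)
    rw [map_sub, map_sub, map_pow, Polynomial.aeval_X, Polynomial.aeval_C, h2, sub_self]
  · intro O' hO'
    exact ASProof.ram p O π hπpos hπ n (hirr n) (hfin n) ⟨θ n, hmemL n⟩ (Subtype.ext (hθ n)) O' hO'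
  · exact Set.infinite_of_injective_forall_mem hinj hfin
end
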